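/- arXiv:1308.5620 — 2 statements merged into one kernel-verified Lean document; each statement's English description precedes it below -/
import Mathlib

section
/- For every a > 0 there exists b > 0 such that the following holds for all n ≥ 2: if P is a set of n points in ℝ² and there exists a line ℓ ⊂ ℝ² containing at least a·n^{7/8} points of P, then P determines at least b·n distinct distances. (This is the quantitative form of: if D(P) = o(n), then no line contains Ω(n^{7/8}) points of P.) -/
/-- Cauchy–Schwarz: a map from `s` to `t` has at least `#s ^ 2 / #t` collisions. -/
theorem card_sq_le_card_mul_card_collisions {α β : Type*} [DecidableEq β]
    (f : α → β) (s : Finset α) (t : Finset β) (h : ∀ x ∈ s, f x ∈ t) :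
    s.card ^ 2 ≤ t.card * ((s ×ˢ s).filter fun p => f p.1 = f p.2).card := by
  have h1 : s.card = ∑ b ∈ t, (s.filter fun x => f x = b).card :=
    Finset.card_eq_sum_card_fiberwise h
  have h2 : ((s ×ˢ s).filter fun p => f p.1 = f p.2).card
      = ∑ b ∈ t, (s.filter fun x => f x = b).card ^ 2 := by
    rw [Finset.card_eq_sum_card_fiberwise (f := fun p => f p.1) (t := t)]
    · refine Finset.sum_congr rfl fun b _ => ?_
      rw [sq, ← Finset.card_product]
      congr 1
      ext ⟨x, y⟩
      simp only [Finset.mem_filter, Finset.mem_product]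
      grind
    · intro p hp
      simp only [Finset.coe_filter, Finset.mem_product, Set.mem_ofPred_eq] at hp
      exact h _ hp.1.1
  rw [h2, h1]
  exact sq_sum_le_card_mul_sum_sq

/-- The index of the block containing `x` when `X` is cut, in increasing order, into consecutive
blocks of `b` elements. -/
noncomputable def blockIndex (X : Finset ℝ) (b : ℕ) (x : ℝ) : ℕ :=
  (X.filter fun z => z < x).card / b

theorem blockIndex_mono (X : Finset ℝ) (b : ℕ) : Monotone (blockIndex X b) := by
  intro x y hxy
  refine Nat.div_le_div_right (Finset.card_le_card fun z hz => ?_)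
  simp only [Finset.mem_filter] at hz ⊢
  exact ⟨hz.1, hz.2.trans_le hxy⟩

theorem blockIndex_le (X : Finset ℝ) (b : ℕ) (x : ℝ) : blockIndex X b x ≤ X.card / b :=
  Nat.div_le_div_right (Finset.card_filter_le _ _)

theorem card_filter_blockIndex_le (X : Finset ℝ) {b : ℕ} (hb : 0 < b) (j : ℕ) :
    (X.filter fun x => blockIndex X b x = j).card ≤ b := by
  have h : (Finset.Ico (j * b) (j * b + b)).card = b := by simp
  refine (Finset.card_le_card_of_injOn (fun x => (X.filter fun z => z < x).card) ?_ ?_).trans_eq h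
  · intro x hx
    replace hx := Finset.mem_filter.1 (Finset.mem_coe.1 hx)
    rw [blockIndex] at hx
    simp only [Finset.coe_Ico, Set.mem_Ico]
    rw [← hx.2]
    exact ⟨Nat.div_mul_le_self _ _, Nat.lt_div_mul_add hb⟩
  · intro x hx y hy hxy
    simp only [Finset.coe_filter, Set.mem_ofPred_eq] at hx hy
    have key : ∀ u ∈ X, ∀ v, u < v →
        (X.filter fun z => z < u).card < (X.filter fun z => z < v).card := by
      intro u hu v huv
      refine Finset.card_lt_card ⟨fun z hz => ?_, fun hs => ?_⟩
      · simp only [Finset.mem_filter] at hz ⊢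
        exact ⟨hz.1, hz.2.trans huv⟩
      · have := hs (Finset.mem_filter.2 ⟨hu, huv⟩)
        simp at this
    rcases lt_trichotomy x y with hlt | heq | hlt
    · exact absurd hxy (key x hx.1 y hlt).ne
    · exact heq
    · exact absurd hxy (key y hy.1 x hlt).ne'

/-- In a grid of sides at most `K` cut into cells of `b * b` points, few pairs of points share
a cell. -/
theorem card_pairs_same_cell_le (G H : Finset ℝ) {b K : ℕ} (hb : 0 < b)
    (hG : G.card ≤ K) (hH : H.card ≤ K) :
    (((G ×ˢ H) ×ˢ (G ×ˢ H)).filter fun p =>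
      blockIndex G b p.1.1 = blockIndex G b p.2.1 ∧
      blockIndex H b p.1.2 = blockIndex H b p.2.2).card ≤ K ^ 2 * b ^ 2 := by
  rw [Finset.card_eq_sum_card_fiberwise (f := fun p => p.1) (t := G ×ˢ H)
    (fun p hp => by simp only [Finset.coe_filter, Set.mem_ofPred_eq, Finset.mem_product] at hp
                    exact Finset.mem_coe.2 (Finset.mem_product.2 hp.1.1))]
  have hle : ∀ g ∈ G ×ˢ H, ((((G ×ˢ H) ×ˢ (G ×ˢ H)).filter fun p =>
      blockIndex G b p.1.1 = blockIndex G b p.2.1 ∧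
      blockIndex H b p.1.2 = blockIndex H b p.2.2).filter fun p => p.1 = g).card ≤ b ^ 2 := by
    intro g _
    calc _ ≤ ((G.filter fun x => blockIndex G b x = blockIndex G b g.1) ×ˢ
          (H.filter fun x => blockIndex H b x = blockIndex H b g.2)).card := by
          refine Finset.card_le_card_of_injOn (fun p => p.2) ?_ ?_
          · rintro ⟨p, q⟩ hp
            simp only [Finset.coe_filter, Finset.mem_filter, Set.mem_ofPred_eq,
              Finset.mem_product, Finset.coe_product, Set.mem_prod] at hp ⊢
            obtain ⟨⟨⟨h1, h2⟩, h3, h4⟩, rfl⟩ := hp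
            exact ⟨⟨h2.1, h3.symm⟩, h2.2, h4.symm⟩
          · rintro ⟨p, q⟩ hp ⟨p', q'⟩ hp' h
            simp only [Finset.coe_filter, Finset.mem_filter, Set.mem_ofPred_eq] at hp hp' h
            rw [hp.2, hp'.2, h]
      _ ≤ b * b := by
          rw [Finset.card_product]
          exact Nat.mul_le_mul (card_filter_blockIndex_le G hb _)
            (card_filter_blockIndex_le H hb _)
      _ = b ^ 2 := (sq b).symm
  calc _ ≤ (G ×ˢ H).card * b ^ 2 := by
        rw [← smul_eq_mul]; exact Finset.sum_le_card_nsmul _ _ _ hle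
    _ ≤ K ^ 2 * b ^ 2 := by
        rw [Finset.card_product, sq K]
        exact Nat.mul_le_mul_right _ (Nat.mul_le_mul hG hH)

/-- A finite subset of `ℝ × ℝ` on which the order relations of the two coordinates agree has many
pairs of distinct points sharing a cell of a coarse grid. -/
theorem card_le_card_chain_pairs_same_cell (S : Finset (ℝ × ℝ)) (G H : Finset ℝ) {b K : ℕ}
    (hG : G.card ≤ K) (hH : H.card ≤ K) (t : ℝ × ℝ)
    (hS : ∀ z ∈ S, ∀ w ∈ S, z.1 ≤ w.1 → z.2 ≤ w.2) (hN : 2 * (2 * (K / b) + 1) ≤ S.card) :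
    S.card ≤ ((S ×ˢ S).filter fun p => p.1 ≠ p.2 ∧
      blockIndex G b (p.1.1 - t.1) = blockIndex G b (p.2.1 - t.1) ∧
      blockIndex H b (p.1.2 - t.2) = blockIndex H b (p.2.2 - t.2)).card := by
  set f : ℝ × ℝ → ℕ := fun z => blockIndex G b (z.1 - t.1) + blockIndex H b (z.2 - t.2) with hf
  have hcs := card_sq_le_card_mul_card_collisions f S (Finset.range (2 * (K / b) + 1)) (by
    intro z _
    have h1 := (blockIndex_le G b (z.1 - t.1)).trans (Nat.div_le_div_right (c := b) hG)
    have h2 := (blockIndex_le H b (z.2 - t.2)).trans (Nat.div_le_div_right (c := b) hH)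
    simp only [hf, Finset.mem_range]
    omega)
  rw [Finset.card_range] at hcs
  set E := (S ×ˢ S).filter fun p => f p.1 = f p.2
  set F := (S ×ˢ S).filter fun p => p.1 ≠ p.2 ∧
      blockIndex G b (p.1.1 - t.1) = blockIndex G b (p.2.1 - t.1) ∧
      blockIndex H b (p.1.2 - t.2) = blockIndex H b (p.2.2 - t.2)
  have hEF : E ⊆ S.image (fun z => (z, z)) ∪ F := by
    rintro ⟨z, w⟩ hzw
    simp only [E, F, hf, Finset.mem_filter, Finset.mem_product, Finset.mem_union,
      Finset.mem_image, Prod.mk.injEq] at hzw ⊢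
    obtain ⟨⟨hz, hw⟩, he⟩ := hzw
    by_cases hne : z = w
    · exact Or.inl ⟨z, hz, rfl, hne⟩
    · refine Or.inr ⟨⟨hz, hw⟩, hne, ?_⟩
      rcases le_total z.1 w.1 with h | h
      · have h1 := blockIndex_mono G b (sub_le_sub_right h t.1)
        have h2 := blockIndex_mono H b (sub_le_sub_right (hS z hz w hw h) t.2)
        omega
      · have h1 := blockIndex_mono G b (sub_le_sub_right h t.1)
        have h2 := blockIndex_mono H b (sub_le_sub_right (hS w hw z hz h) t.2)
        omega
  have hc : E.card ≤ S.card + F.card :=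
    (Finset.card_le_card hEF).trans ((Finset.card_union_le _ _).trans
      (Nat.add_le_add_right Finset.card_image_le _))
  have hpos : 0 < S.card := by omega
  have h3 : 2 * S.card ≤ E.card := by
    by_contra! hlt
    nlinarith
  omega

theorem hyperbola_chord_unique {c x y x' y' d e : ℝ} (hc : c ≠ 0)
    (hx : 0 ≤ x) (hy : 0 ≤ y) (hx' : 0 ≤ x') (hy' : 0 ≤ y')
    (hxd : 0 ≤ x + d) (hye : 0 ≤ y + e) (hxd' : 0 ≤ x' + d) (hye' : 0 ≤ y' + e)
    (h1 : x ^ 2 - y ^ 2 = c) (h2 : (x + d) ^ 2 - (y + e) ^ 2 = c)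
    (h3 : x' ^ 2 - y' ^ 2 = c) (h4 : (x' + d) ^ 2 - (y' + e) ^ 2 = c)
    (hne : d ≠ 0 ∨ e ≠ 0) : x = x' ∧ y = y' := by
  by_contra hcon
  have h5 : d * (x - x') = e * (y - y') := by linarith
  have h6 : (x + x') * (x - x') = (y + y') * (y - y') := by linarith
  have h7 : d * ((x + x') + d) = e * ((y + y') + e) := by linarith
  have h8 : d * (y + y') = e * (x + x') := by
    by_cases hδ : x - x' = 0
    · have hη : y - y' ≠ 0 := fun h => hcon ⟨by linarith, by linarith⟩
      refine mul_right_cancel₀ hη ?_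
      linear_combination d * (-h6) + (x + x') * h5
    · refine mul_right_cancel₀ hδ ?_
      linear_combination (y + y') * h5 - e * h6
  have h9 : (d - e) * ((d + e) * (x + x' + d)) = 0 := by
    linear_combination d * h7 + e * h8
  rcases mul_eq_zero.1 h9 with h | h
  · have hde : d = e := by linarith
    subst hde
    have hd : d ≠ 0 := by simpa using hne
    have : x = y := mul_left_cancel₀ hd (by linarith)
    exact hc (by rw [← h1, this]; ring)
  rcases mul_eq_zero.1 h with h | h
  · have hde : d = -e := by linarith
    subst hde
    have he : e ≠ 0 := by simpa using hne
    have : y + y' = -(x + x') := mul_left_cancel₀ he (by linarith)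
    have hx0 : x = 0 := by linarith
    have hy0 : y = 0 := by linarith
    exact hc (by rw [← h1, hx0, hy0]; ring)
  · have hd : d = 0 := by linarith
    rw [h, mul_zero] at h7
    rcases mul_eq_zero.1 h7.symm with he | he
    · exact hne.elim (· hd) (· he)
    · exact hne.elim (· hd) (fun h' => h' (by linarith))

open scoped Pointwise in
/-- If `X` and `Y` have `m` elements and small difference sets, then the branch in the first
quadrant of a nondegenerate hyperbola `x ^ 2 - y ^ 2 = c` contains few points of `X × Y`. -/
theorem card_sq_mul_card_hyperbola_cube_le (X Y : Finset ℝ) {m K : ℕ} (hX : X.card = m)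
    (hY : Y.card = m) (hXK : (X - X).card ≤ K) (hYK : (Y - Y).card ≤ K) {c : ℝ} (hc : c ≠ 0) :
    m ^ 2 * ((X ×ˢ Y).filter fun z => 0 ≤ z.1 ∧ 0 ≤ z.2 ∧ z.1 ^ 2 - z.2 ^ 2 = c).card ^ 3
      ≤ 81 * K ^ 4 := by
  set S := (X ×ˢ Y).filter fun z => 0 ≤ z.1 ∧ 0 ≤ z.2 ∧ z.1 ^ 2 - z.2 ^ 2 = c with hSdef
  have hS : ∀ z ∈ S, (z.1 ∈ X ∧ z.2 ∈ Y) ∧ 0 ≤ z.1 ∧ 0 ≤ z.2 ∧ z.1 ^ 2 - z.2 ^ 2 = c := by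
    intro z hz
    simpa [hSdef] using hz
  have hmK : m ≤ K := hX ▸ Finset.card_le_card_sub_self.trans hXK
  have hrm : S.card ≤ m := by
    rw [← hX]
    refine Finset.card_le_card_of_injOn (fun z => z.1) (fun z hz => (hS z hz).1.1) ?_
    intro z hz w hw h
    obtain ⟨-, -, h1, h2⟩ := hS z hz
    obtain ⟨-, -, h3, h4⟩ := hS w hw
    simp only at h
    refine Prod.ext h ?_
    rw [← h] at h4
    exact (sq_eq_sq₀ h1 h3).1 (by linarith)
  set r := S.card with hr
  by_cases hr4 : r < 4
  · have h1 : r ^ 3 ≤ 27 := by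
      calc r ^ 3 ≤ 3 ^ 3 := Nat.pow_le_pow_left (by omega) 3
        _ = 27 := by norm_num
    have h2 : m ^ 2 ≤ K ^ 4 := by
      rcases Nat.eq_zero_or_pos m with h | h
      · simp [h]
      · exact (Nat.pow_le_pow_left hmK 2).trans (Nat.pow_le_pow_right (by omega) (by norm_num))
    nlinarith [Nat.mul_le_mul h2 h1]
  push Not at hr4
  set b := 8 * K / r + 1 with hb
  have hb0 : 0 < b := Nat.succ_pos _
  have hb1 : 8 * K < r * b := Nat.lt_mul_div_succ _ (by omega)
  have hb2 : r * b ≤ 9 * K := by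
    have : r * (8 * K / r) ≤ 8 * K := Nat.mul_div_le _ _
    rw [hb, mul_add]
    omega
  have hN : 2 * (2 * (K / b) + 1) ≤ r := by
    have h1 : K / b * b ≤ K := Nat.div_mul_le_self _ _
    have h2 : 8 * (K / b) < r := by
      by_contra! h
      nlinarith [Nat.mul_le_mul_right b h]
    omega
  have hchain : ∀ z ∈ S, ∀ w ∈ S, z.1 ≤ w.1 → z.2 ≤ w.2 := by
    intro z hz w hw h
    obtain ⟨-, h0, h1, h2⟩ := hS z hz
    obtain ⟨-, h0', h3, h4⟩ := hS w hw
    exact (sq_le_sq₀ h1 h3).1 (by nlinarith)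
  set U := ((X ×ˢ Y) ×ˢ (S ×ˢ S)).filter fun u => u.2.1 ≠ u.2.2 ∧
      blockIndex (X - X) b (u.2.1.1 - u.1.1) = blockIndex (X - X) b (u.2.2.1 - u.1.1) ∧
      blockIndex (Y - Y) b (u.2.1.2 - u.1.2) = blockIndex (Y - Y) b (u.2.2.2 - u.1.2) with hU
  have hlow : m ^ 2 * r ≤ U.card := by
    rw [Finset.card_eq_sum_card_fiberwise (f := fun u => u.1) (s := U) (t := X ×ˢ Y)
      (fun u hu => by
        simp only [hU, Finset.coe_filter, Set.mem_ofPred_eq, Finset.mem_product] at hu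
        exact Finset.mem_coe.2 (Finset.mem_product.2 hu.1.1))]
    calc m ^ 2 * r = (X ×ˢ Y).card • r := by rw [Finset.card_product, hX, hY, smul_eq_mul, sq]
      _ ≤ _ := by
        refine Finset.card_nsmul_le_sum _ _ _ fun t ht => ?_
        refine (card_le_card_chain_pairs_same_cell S (X - X) (Y - Y) (b := b) hXK hYK t hchain
          hN).trans ?_
        refine Finset.card_le_card_of_injOn (fun p => (t, p)) ?_ ?_
        · intro p hp
          simp only [hU, Finset.coe_filter, Finset.mem_filter, Set.mem_ofPred_eq,
            Finset.mem_product] at hp ht ⊢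
          exact ⟨⟨⟨ht, hp.1⟩, hp.2⟩, trivial⟩
        · intro p _ q _ h
          simpa using h
  have hupp : U.card ≤ K ^ 2 * b ^ 2 := by
    refine le_trans ?_ (card_pairs_same_cell_le (X - X) (Y - Y) hb0 hXK hYK)
    refine Finset.card_le_card_of_injOn (fun u => (u.2.1 - u.1, u.2.2 - u.1)) ?_ ?_
    · rintro ⟨t, z, w⟩ hu
      simp only [hU, Finset.coe_filter, Set.mem_ofPred_eq, Finset.mem_product, Prod.fst_sub,
        Prod.snd_sub] at hu ⊢
      obtain ⟨⟨ht, hz, hw⟩, -, hcell⟩ := hu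
      exact ⟨⟨⟨Finset.sub_mem_sub (hS z hz).1.1 ht.1, Finset.sub_mem_sub (hS z hz).1.2 ht.2⟩,
        Finset.sub_mem_sub (hS w hw).1.1 ht.1, Finset.sub_mem_sub (hS w hw).1.2 ht.2⟩, hcell⟩
    · rintro ⟨⟨t1, t2⟩, ⟨z1, z2⟩, ⟨w1, w2⟩⟩ hu ⟨⟨t1', t2'⟩, ⟨z1', z2'⟩, ⟨w1', w2'⟩⟩ hu' h
      simp only [hU, Finset.coe_filter, Set.mem_ofPred_eq, Finset.mem_product] at hu hu'
      obtain ⟨⟨-, hz, hw⟩, hne, -⟩ := hu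
      obtain ⟨⟨-, hz', hw'⟩, -, -⟩ := hu'
      obtain ⟨-, hz1, hz2, hz3⟩ := hS _ hz
      obtain ⟨-, hw1, hw2, hw3⟩ := hS _ hw
      obtain ⟨-, hz1', hz2', hz3'⟩ := hS _ hz'
      obtain ⟨-, hw1', hw2', hw3'⟩ := hS _ hw'
      simp only [Prod.mk_sub_mk, Prod.mk.injEq] at h hz1 hz2 hz3 hw1 hw2 hw3
      simp only at hz1' hz2' hz3' hw1' hw2' hw3'
      obtain ⟨⟨ha, hb⟩, hc', hd⟩ := h
      have e1 : z1 + (w1 - z1) = w1 := by ring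
      have e2 : z2 + (w2 - z2) = w2 := by ring
      have e3 : z1' + (w1 - z1) = w1' := by linarith
      have e4 : z2' + (w2 - z2) = w2' := by linarith
      obtain ⟨i1, i2⟩ := hyperbola_chord_unique (d := w1 - z1) (e := w2 - z2) hc hz1 hz2 hz1' hz2'
        (by rwa [e1]) (by rwa [e2]) (by rwa [e3]) (by rwa [e4]) hz3 (by rwa [e1, e2]) hz3'
        (by rwa [e3, e4]) (by
          by_contra! hcon
          exact hne (Prod.ext (by simp only; linarith) (by simp only; linarith)))
      simp only [Prod.mk.injEq]
      refine ⟨⟨?_, ?_⟩, ⟨?_, ?_⟩, ?_, ?_⟩ <;> linarith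
  have h1 := Nat.mul_le_mul_right (r ^ 2) (hlow.trans hupp)
  have h2 := Nat.mul_le_mul_left (K ^ 2) (Nat.pow_le_pow_left hb2 2)
  calc m ^ 2 * r ^ 3 = m ^ 2 * r * r ^ 2 := by ring
    _ ≤ K ^ 2 * b ^ 2 * r ^ 2 := h1
    _ = K ^ 2 * (r * b) ^ 2 := by ring
    _ ≤ K ^ 2 * (9 * K) ^ 2 := h2
    _ = 81 * K ^ 4 := by ring

open scoped Pointwise in
/-- A nondegenerate hyperbola contains few points of `A × A` when `A - A` is small. -/
theorem card_hyperbola_le (A : Finset ℝ) {K R : ℕ} (hK : (A - A).card ≤ K)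
    (hR : ∀ r, A.card ^ 2 * r ^ 3 ≤ 81 * K ^ 4 → r ≤ R) (p q : ℝ) {c : ℝ} (hc : c ≠ 0) :
    ((A ×ˢ A).filter fun z => (z.1 - p) ^ 2 - (z.2 - q) ^ 2 = c).card ≤ 4 * R := by
  have hinj : ∀ σ : ℝ, σ ^ 2 = 1 → ∀ t : ℝ, Function.Injective fun x : ℝ => σ * (x - t) := by
    intro σ hσ t x y hxy
    have hσ0 : σ ≠ 0 := by rintro rfl; norm_num at hσ
    simpa using mul_left_cancel₀ hσ0 hxy
  have hdiff : ∀ σ t : ℝ, (A.image (fun x => σ * (x - t)) - A.image (fun x => σ * (x - t))).card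
      ≤ K := by
    intro σ t
    refine le_trans (Finset.card_le_card (t := (A - A).image fun x => σ * x) ?_)
      (Finset.card_image_le.trans hK)
    intro z hz
    obtain ⟨x, hx, y, hy, rfl⟩ := Finset.mem_sub.1 hz
    obtain ⟨x', hx', rfl⟩ := Finset.mem_image.1 hx
    obtain ⟨y', hy', rfl⟩ := Finset.mem_image.1 hy
    exact Finset.mem_image.2 ⟨x' - y', Finset.sub_mem_sub hx' hy', by ring⟩
  have hquad : ∀ σ τ : ℝ, σ ^ 2 = 1 → τ ^ 2 = 1 → ((A ×ˢ A).filter fun z =>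
      0 ≤ σ * (z.1 - p) ∧ 0 ≤ τ * (z.2 - q) ∧ (z.1 - p) ^ 2 - (z.2 - q) ^ 2 = c).card ≤ R := by
    intro σ τ hσ hτ
    refine le_trans (Finset.card_le_card_of_injOn
      (fun z => (σ * (z.1 - p), τ * (z.2 - q))) ?_ ?_)
      (hR _ (card_sq_mul_card_hyperbola_cube_le (A.image fun x => σ * (x - p))
        (A.image fun x => τ * (x - q)) (Finset.card_image_of_injective _ (hinj σ hσ p))
        (Finset.card_image_of_injective _ (hinj τ hτ q)) (hdiff σ p) (hdiff τ q) hc))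
    · intro z hz
      simp only [Finset.coe_filter, Set.mem_ofPred_eq, Finset.mem_product] at hz ⊢
      obtain ⟨⟨h1, h2⟩, h3, h4, h5⟩ := hz
      refine ⟨⟨Finset.mem_image_of_mem _ h1, Finset.mem_image_of_mem _ h2⟩, h3, h4, ?_⟩
      rw [mul_pow, mul_pow, hσ, hτ, one_mul, one_mul, h5]
    · intro z _ w _ hzw
      simp only [Prod.mk.injEq] at hzw
      exact Prod.ext (hinj σ hσ p hzw.1) (hinj τ hτ q hzw.2)
  have h1 := hquad 1 1 (by norm_num) (by norm_num)
  have h2 := hquad 1 (-1) (by norm_num) (by norm_num)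
  have h3 := hquad (-1) 1 (by norm_num) (by norm_num)
  have h4 := hquad (-1) (-1) (by norm_num) (by norm_num)
  set H : ℝ → ℝ → Finset (ℝ × ℝ) := fun σ τ => (A ×ˢ A).filter fun z =>
      0 ≤ σ * (z.1 - p) ∧ 0 ≤ τ * (z.2 - q) ∧ (z.1 - p) ^ 2 - (z.2 - q) ^ 2 = c with hH
  have hsub : ((A ×ˢ A).filter fun z => (z.1 - p) ^ 2 - (z.2 - q) ^ 2 = c) ⊆
      (H 1 1 ∪ H 1 (-1)) ∪ (H (-1) 1 ∪ H (-1) (-1)) := by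
    intro z hz
    obtain ⟨hz1, hz2⟩ := Finset.mem_filter.1 hz
    simp only [hH, Finset.mem_union, Finset.mem_filter, hz1, hz2, true_and, and_true]
    rcases le_total 0 (z.1 - p) with ha | ha <;> rcases le_total 0 (z.2 - q) with hb | hb
    · exact Or.inl (Or.inl ⟨by linarith, by linarith⟩)
    · exact Or.inl (Or.inr ⟨by linarith, by linarith⟩)
    · exact Or.inr (Or.inl ⟨by linarith, by linarith⟩)
    · exact Or.inr (Or.inr ⟨by linarith, by linarith⟩)
  have h5 := Finset.card_le_card hsub
  have h6 := Finset.card_union_le (H 1 1 ∪ H 1 (-1)) (H (-1) 1 ∪ H (-1) (-1))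
  have h7 := Finset.card_union_le (H 1 1) (H 1 (-1))
  have h8 := Finset.card_union_le (H (-1) 1) (H (-1) (-1))
  change (H 1 1).card ≤ R at h1
  change (H 1 (-1)).card ≤ R at h2
  change (H (-1) 1).card ≤ R at h3
  change (H (-1) (-1)).card ≤ R at h4
  omega

theorem card_degenerate_hyperbola_le (A : Finset ℝ) (p q : ℝ) :
    ((A ×ˢ A).filter fun z => (z.1 - p) ^ 2 - (z.2 - q) ^ 2 = 0).card ≤ 2 * A.card := by
  have hsub : ((A ×ˢ A).filter fun z => (z.1 - p) ^ 2 - (z.2 - q) ^ 2 = 0) ⊆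
      A.image (fun x => (x, q + (x - p))) ∪ A.image (fun x => (x, q - (x - p))) := by
    rintro ⟨x, y⟩ hz
    simp only [Finset.mem_filter, Finset.mem_product, Finset.mem_union, Finset.mem_image,
      Prod.mk.injEq] at hz ⊢
    obtain ⟨⟨hx, -⟩, h⟩ := hz
    rcases sq_eq_sq_iff_eq_or_eq_neg.1 (sub_eq_zero.1 h) with h | h
    · exact Or.inl ⟨x, hx, rfl, by linarith⟩
    · exact Or.inr ⟨x, hx, rfl, by linarith⟩
  have h1 := Finset.card_le_card hsub
  have h2 := Finset.card_union_le (A.image fun x => (x, q + (x - p)))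
    (A.image fun x => (x, q - (x - p)))
  have h3 := Finset.card_image_le (s := A) (f := fun x => (x, q + (x - p)))
  have h4 := Finset.card_image_le (s := A) (f := fun x => (x, q - (x - p)))
  omega

open scoped Pointwise in
/-- If the horizontal line at height `h` contains `m` points of `P`, and no horizontal line contains
more, then a set containing all squared distances of `P` is large in terms of `#P` or `m`. -/
theorem card_le_or_pow_le_card_sqdist (P : Finset (ℝ × ℝ)) (h : ℝ) (Δ : Finset ℝ)
    (hmax : ∀ k, (P.filter fun p => p.2 = k).card ≤ (P.filter fun p => p.2 = h).card)
    (hΔ : ∀ p ∈ P, ∀ q ∈ P, (p.1 - q.1) ^ 2 + (p.2 - q.2) ^ 2 ∈ Δ) :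
    P.card ≤ 8 * Δ.card ∨ (P.filter fun p => p.2 = h).card ^ 8 ≤ 663552 * Δ.card ^ 7 := by
  set A := (P.filter fun p => p.2 = h).image Prod.fst with hA
  have hmem : ∀ x ∈ A, (x, h) ∈ P := by
    intro x hx
    obtain ⟨p, hp, rfl⟩ := Finset.mem_image.1 hx
    obtain ⟨hp, hph⟩ := Finset.mem_filter.1 hp
    rwa [← hph]
  have hAm : A.card = (P.filter fun p => p.2 = h).card := by
    refine Finset.card_image_of_injOn fun p hp q hq hpq => ?_
    simp only [Finset.coe_filter, Set.mem_ofPred_eq] at hp hq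
    exact Prod.ext hpq (hp.2.trans hq.2.symm)
  rw [← hAm] at hmax ⊢
  set m := A.card with hm
  set n := P.card with hn
  set D := Δ.card with hD
  by_cases hnD : n ≤ 8 * D
  · exact Or.inl hnD
  push Not at hnD
  refine Or.inr ?_
  rcases Nat.eq_zero_or_pos m with hm0 | hm0
  · simp [hm0]
  have hK : (A - A).card ≤ 2 * D := by
    have hsub : A - A ⊆ Δ.image Real.sqrt ∪ Δ.image (fun d => -Real.sqrt d) := by
      intro z hz
      obtain ⟨x, hx, y, hy, rfl⟩ := Finset.mem_sub.1 hz
      have hd := hΔ _ (hmem x hx) _ (hmem y hy)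
      simp only [sub_self, ne_eq, OfNat.ofNat_ne_zero, not_false_eq_true, zero_pow,
        add_zero] at hd
      rcases le_total 0 (x - y) with hxy | hxy
      · exact Finset.mem_union_left _ (Finset.mem_image.2 ⟨_, hd, Real.sqrt_sq hxy⟩)
      · refine Finset.mem_union_right _ (Finset.mem_image.2 ⟨_, hd, ?_⟩)
        rw [Real.sqrt_sq_eq_abs, abs_of_nonpos hxy, neg_neg]
    have h1 := Finset.card_le_card hsub
    have h2 := Finset.card_union_le (Δ.image Real.sqrt) (Δ.image fun d => -Real.sqrt d)
    have h3 := Finset.card_image_le (s := Δ) (f := Real.sqrt)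
    have h4 := Finset.card_image_le (s := Δ) (f := fun d => -Real.sqrt d)
    omega
  obtain ⟨R, hR1, hR⟩ : ∃ R, m ^ 2 * R ^ 3 ≤ 81 * (2 * D) ^ 4 ∧
      ∀ r, m ^ 2 * r ^ 3 ≤ 81 * (2 * D) ^ 4 → r ≤ R := by
    refine ⟨Nat.findGreatest (fun r => m ^ 2 * r ^ 3 ≤ 81 * (2 * D) ^ 4) (81 * (2 * D) ^ 4),
      Nat.findGreatest_spec (P := fun r => m ^ 2 * r ^ 3 ≤ 81 * (2 * D) ^ 4) (Nat.zero_le _)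
        (by simp), fun r hr => Nat.le_findGreatest ?_ hr⟩
    calc r ≤ r ^ 3 := Nat.le_self_pow (by norm_num) r
      _ ≤ m ^ 2 * r ^ 3 := Nat.le_mul_of_pos_left _ (by positivity)
      _ ≤ _ := hr
  set f : ℝ × (ℝ × ℝ) → ℝ := fun u => (u.1 - u.2.1) ^ 2 + (h - u.2.2) ^ 2 with hf
  have hcs := card_sq_le_card_mul_card_collisions f (A ×ˢ P) Δ (by
    rintro ⟨x, p⟩ hu
    obtain ⟨hx, hp⟩ := Finset.mem_product.1 hu
    exact hΔ _ (hmem x hx) _ hp)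
  rw [Finset.card_product] at hcs
  set Q := ((A ×ˢ P) ×ˢ (A ×ˢ P)).filter fun u => f u.1 = f u.2 with hQ
  have hdeg : ((P ×ˢ P).filter fun w => (h - w.2.2) ^ 2 - (h - w.1.2) ^ 2 = 0).card
      ≤ n * (2 * m) := by
    rw [Finset.card_eq_sum_card_fiberwise (f := Prod.fst) (t := P)
      (fun w hw => (Finset.mem_product.1 (Finset.mem_filter.1 (Finset.mem_coe.1 hw)).1).1),
      ← smul_eq_mul]
    refine Finset.sum_le_card_nsmul _ _ _ fun p _ => ?_
    have h1 : (((P ×ˢ P).filter fun w => (h - w.2.2) ^ 2 - (h - w.1.2) ^ 2 = 0).filter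
        fun w => w.1 = p).card ≤ ((P.filter fun q => q.2 = p.2) ∪
          (P.filter fun q => q.2 = 2 * h - p.2)).card := by
      refine Finset.card_le_card_of_injOn Prod.snd ?_ ?_
      · rintro ⟨p', q⟩ hw
        simp only [Finset.coe_filter, Finset.mem_filter, Finset.mem_product, Set.mem_ofPred_eq,
          Finset.coe_union, Set.mem_union] at hw ⊢
        obtain ⟨⟨⟨-, hq⟩, h1⟩, rfl⟩ := hw
        rcases sq_eq_sq_iff_eq_or_eq_neg.1 (sub_eq_zero.1 h1) with h1 | h1
        · exact Or.inl ⟨hq, by linarith⟩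
        · exact Or.inr ⟨hq, by linarith⟩
      · intro w hw w' hw' hww
        replace hw := (Finset.mem_filter.1 (Finset.mem_coe.1 hw)).2
        replace hw' := (Finset.mem_filter.1 (Finset.mem_coe.1 hw')).2
        exact Prod.ext (hw.trans hw'.symm) hww
    have h2 := Finset.card_union_le (P.filter fun q => q.2 = p.2)
      (P.filter fun q => q.2 = 2 * h - p.2)
    have h3 := hmax p.2
    have h4 := hmax (2 * h - p.2)
    omega
  have hQle : Q.card ≤ n ^ 2 * (4 * R) + n * (2 * m) * (2 * m) := by
    rw [Finset.card_eq_sum_card_fiberwise (f := fun u => (u.1.2, u.2.2)) (s := Q) (t := P ×ˢ P)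
      (fun u hu => by
        simp only [hQ, Finset.coe_filter, Set.mem_ofPred_eq, Finset.mem_product] at hu
        exact Finset.mem_coe.2 (Finset.mem_product.2 ⟨hu.1.1.2, hu.1.2.2⟩))]
    calc _ ≤ ∑ w ∈ P ×ˢ P, (4 * R + if (h - w.2.2) ^ 2 - (h - w.1.2) ^ 2 = 0
            then 2 * m else 0) := by
          refine Finset.sum_le_sum fun w _ => ?_
          have h1 : (Q.filter fun u => (u.1.2, u.2.2) = w).card ≤ ((A ×ˢ A).filter fun z =>
              (z.1 - w.1.1) ^ 2 - (z.2 - w.2.1) ^ 2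
                = (h - w.2.2) ^ 2 - (h - w.1.2) ^ 2).card := by
            refine Finset.card_le_card_of_injOn (fun u => (u.1.1, u.2.1)) ?_ ?_
            · rintro ⟨⟨x, p⟩, ⟨y, q⟩⟩ hu
              simp only [hQ, hf, Finset.coe_filter, Finset.mem_filter, Finset.mem_product,
                Set.mem_ofPred_eq] at hu ⊢
              obtain ⟨⟨⟨⟨hx, -⟩, hy, -⟩, he⟩, rfl⟩ := hu
              exact ⟨⟨hx, hy⟩, by simp only; linarith⟩
            · rintro ⟨⟨x, p⟩, ⟨y, q⟩⟩ hu ⟨⟨x', p'⟩, ⟨y', q'⟩⟩ hu' hxy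
              replace hu := (Finset.mem_filter.1 (Finset.mem_coe.1 hu)).2
              replace hu' := (Finset.mem_filter.1 (Finset.mem_coe.1 hu')).2
              grind
          refine h1.trans ?_
          split_ifs with hc
          · rw [hc]
            exact (card_degenerate_hyperbola_le A _ _).trans (Nat.le_add_left _ _)
          · exact card_hyperbola_le A hK hR _ _ hc
      _ ≤ _ := by
          rw [Finset.sum_add_distrib, Finset.sum_const, ← Finset.sum_filter, Finset.sum_const,
            Finset.card_product, smul_eq_mul, smul_eq_mul, sq]
          exact Nat.add_le_add_left (Nat.mul_le_mul_right _ hdeg) _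
  have hn0 : 0 < n := by omega
  have hmR : m ^ 2 ≤ 8 * D * R := by
    have h1 := hcs.trans (Nat.mul_le_mul_left D hQle)
    have h2 := Nat.mul_le_mul_right (m ^ 2 * n) hnD.le
    refine le_of_mul_le_mul_left (a := n ^ 2) ?_ (pow_pos hn0 2)
    nlinarith
  calc m ^ 8 = m ^ 2 * (m ^ 2) ^ 3 := by ring
    _ ≤ m ^ 2 * (8 * D * R) ^ 3 := Nat.mul_le_mul_left _ (Nat.pow_le_pow_left hmR 3)
    _ = 512 * D ^ 3 * (m ^ 2 * R ^ 3) := by ring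
    _ ≤ 512 * D ^ 3 * (81 * (2 * D) ^ 4) := Nat.mul_le_mul_left _ hR1
    _ = 663552 * D ^ 7 := by ring

/-- The map sending the direction `(α, β)` to the horizontal direction, up to scaling. -/
noncomputable def rotateScale (α β : ℝ) (p : EuclideanSpace ℝ (Fin 2)) : ℝ × ℝ :=
  (α * p 0 + β * p 1, α * p 1 - β * p 0)

theorem rotateScale_sqdist (α β : ℝ) (p q : EuclideanSpace ℝ (Fin 2)) :
    ((rotateScale α β p).1 - (rotateScale α β q).1) ^ 2 +
      ((rotateScale α β p).2 - (rotateScale α β q).2) ^ 2 = (α ^ 2 + β ^ 2) * dist p q ^ 2 := by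
  rw [EuclideanSpace.dist_eq, Real.sq_sqrt (by positivity)]
  simp only [rotateScale, Fin.sum_univ_two, Real.dist_eq, sq_abs]
  ring

theorem rotateScale_injective {α β : ℝ} (h : α ^ 2 + β ^ 2 ≠ 0) :
    Function.Injective (rotateScale α β) := by
  intro p q hpq
  have h1 := rotateScale_sqdist α β p q
  rw [hpq] at h1
  have h2 : dist p q ^ 2 = 0 := by
    have h3 : (α ^ 2 + β ^ 2) * dist p q ^ 2 = 0 := by linarith
    exact (mul_eq_zero.1 h3).resolve_left h
  exact dist_eq_zero.1 (pow_eq_zero_iff two_ne_zero |>.1 h2)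

theorem exists_rotateScale_snd_eq (ℓ : AffineSubspace ℝ (EuclideanSpace ℝ (Fin 2)))
    (hℓ : Module.finrank ℝ ℓ.direction = 1) :
    ∃ α β : ℝ, α ^ 2 + β ^ 2 ≠ 0 ∧ ∀ p ∈ ℓ, ∀ q ∈ ℓ,
      (rotateScale α β p).2 = (rotateScale α β q).2 := by
  obtain ⟨⟨v, hv⟩, hv0, hspan⟩ := finrank_eq_one_iff'.1 hℓ
  refine ⟨v 0, v 1, fun h => hv0 ?_, fun p hp q hq => ?_⟩
  · have h0 : v 0 = 0 := by nlinarith [sq_nonneg (v 0), sq_nonneg (v 1)]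
    have h1 : v 1 = 0 := by nlinarith [sq_nonneg (v 0), sq_nonneg (v 1)]
    ext i
    fin_cases i
    · simpa using h0
    · simpa using h1
  · obtain ⟨c, hc⟩ := hspan ⟨p -ᵥ q, AffineSubspace.vsub_mem_direction hp hq⟩
    have hc' : c • v = p - q := congrArg Subtype.val hc
    have h0 : c * v 0 = p 0 - q 0 := by simpa using congrArg (fun w => w 0) hc'
    have h1 : c * v 1 = p 1 - q 1 := by simpa using congrArg (fun w => w 1) hc'
    simp only [rotateScale]
    linear_combination v 1 * h0 - v 0 * h1

theorem card_le_or_ncard_inter_line_pow_le (P : Finset (EuclideanSpace ℝ (Fin 2)))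
    (hP : 2 ≤ P.card) (ℓ : AffineSubspace ℝ (EuclideanSpace ℝ (Fin 2)))
    (hℓ : Module.finrank ℝ ℓ.direction = 1) :
    P.card ≤ 16 * {d : ℝ | ∃ p ∈ P, ∃ q ∈ P, p ≠ q ∧ d = dist p q}.ncard ∨
      ((P : Set (EuclideanSpace ℝ (Fin 2))) ∩ (ℓ : Set (EuclideanSpace ℝ (Fin 2)))).ncard ^ 8 ≤
        663552 * (2 * {d : ℝ | ∃ p ∈ P, ∃ q ∈ P, p ≠ q ∧ d = dist p q}.ncard) ^ 7 := by
  classical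
  set S := {d : ℝ | ∃ p ∈ P, ∃ q ∈ P, p ≠ q ∧ d = dist p q} with hS
  have hfin : S.Finite := by
    refine ((P ×ˢ P).image fun w => dist w.1 w.2).finite_toSet.subset ?_
    rintro _ ⟨p, hp, q, hq, -, rfl⟩
    exact Finset.mem_coe.2 (Finset.mem_image.2 ⟨(p, q), Finset.mem_product.2 ⟨hp, hq⟩, rfl⟩)
  have hpos : 0 < S.ncard := by
    obtain ⟨p, hp, q, hq, hpq⟩ := Finset.one_lt_card.1 hP
    exact (Set.ncard_pos hfin).2 ⟨_, p, hp, q, hq, hpq, rfl⟩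
  obtain ⟨α, β, hαβ, hline⟩ := exists_rotateScale_snd_eq ℓ hℓ
  have hinj := rotateScale_injective hαβ
  set P' := P.image (rotateScale α β) with hP'
  set Δ := insert 0 (hfin.toFinset.image fun d => (α ^ 2 + β ^ 2) * d ^ 2) with hΔ
  have hΔcard : Δ.card ≤ 2 * S.ncard := by
    have h1 := Finset.card_insert_le 0 (hfin.toFinset.image fun d => (α ^ 2 + β ^ 2) * d ^ 2)
    have h2 := Finset.card_image_le (s := hfin.toFinset)
      (f := fun d => (α ^ 2 + β ^ 2) * d ^ 2)
    rw [← Set.ncard_eq_toFinset_card S hfin] at h2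
    rw [hΔ]
    omega
  have hΔmem : ∀ p ∈ P', ∀ q ∈ P', (p.1 - q.1) ^ 2 + (p.2 - q.2) ^ 2 ∈ Δ := by
    intro p hp q hq
    obtain ⟨x, hx, rfl⟩ := Finset.mem_image.1 hp
    obtain ⟨y, hy, rfl⟩ := Finset.mem_image.1 hq
    rw [rotateScale_sqdist, hΔ]
    by_cases hxy : x = y
    · simp [hxy]
    · exact Finset.mem_insert_of_mem (Finset.mem_image_of_mem _
        (hfin.mem_toFinset.2 ⟨x, hx, y, hy, hxy, rfl⟩))
  have hcard : P'.card = P.card := Finset.card_image_of_injective _ hinj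
  have hne : (P'.image Prod.snd).Nonempty := by
    rw [Finset.image_nonempty, ← Finset.card_pos]
    omega
  obtain ⟨h, -, hmax⟩ := Finset.exists_max_image (P'.image Prod.snd)
    (fun k => (P'.filter fun p => p.2 = k).card) hne
  have hmax' : ∀ k, (P'.filter fun p => p.2 = k).card ≤ (P'.filter fun p => p.2 = h).card := by
    intro k
    by_cases hk : k ∈ P'.image Prod.snd
    · exact hmax k hk
    · rw [Finset.filter_eq_empty_iff.2 fun p hp hpk => hk (Finset.mem_image.2 ⟨p, hp, hpk⟩)]
      simp
  have hle : ((P : Set (EuclideanSpace ℝ (Fin 2))) ∩ ℓ).ncard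
      ≤ (P'.filter fun p => p.2 = h).card := by
    rcases ((P : Set (EuclideanSpace ℝ (Fin 2))) ∩ ℓ).eq_empty_or_nonempty with he | ⟨o, -, ho⟩
    · simp [he]
    · refine le_trans ?_ (hmax' (rotateScale α β o).2)
      rw [← Set.ncard_coe_finset]
      refine Set.ncard_le_ncard_of_injOn (rotateScale α β) ?_ hinj.injOn (Finset.finite_toSet _)
      rintro p ⟨hp, hpℓ⟩
      exact Finset.mem_coe.2 (Finset.mem_filter.2
        ⟨Finset.mem_image_of_mem _ (Finset.mem_coe.1 hp), hline p hpℓ o ho⟩)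
  rcases card_le_or_pow_le_card_sqdist P' h Δ hmax' hΔmem with h1 | h1
  · left
    omega
  · right
    calc _ ≤ (P'.filter fun p => p.2 = h).card ^ 8 := Nat.pow_le_pow_left hle 8
      _ ≤ 663552 * Δ.card ^ 7 := h1
      _ ≤ _ := Nat.mul_le_mul_left _ (Nat.pow_le_pow_left hΔcard 7)

/-- If a set `P` of `n ≥ 2` points in the plane has a line containing at least
`a · n^(7/8)` of its points, then `P` determines at least `b · n` distinct distances. -/
theorem few_distances_implies_no_heavy_line :
    ∀ a : ℝ, 0 < a → ∃ b : ℝ, 0 < b ∧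
      ∀ n : ℕ, 2 ≤ n →
      ∀ P : Finset (EuclideanSpace ℝ (Fin 2)), P.card = n →
      ∀ ℓ : AffineSubspace ℝ (EuclideanSpace ℝ (Fin 2)),
        Module.finrank ℝ ℓ.direction = 1 →
        a * (n : ℝ) ^ ((7 : ℝ) / 8) ≤
          (((P : Set (EuclideanSpace ℝ (Fin 2))) ∩ (ℓ : Set (EuclideanSpace ℝ (Fin 2)))).ncard : ℝ) →
        b * (n : ℝ) ≤
          (({d : ℝ | ∃ p ∈ P, ∃ q ∈ P, p ≠ q ∧ d = dist p q}).ncard : ℝ) := by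
  intro a ha
  refine ⟨min (1 / 16) ((a ^ 8 / (663552 * 2 ^ 7)) ^ ((1 : ℝ) / 7)), by positivity, ?_⟩
  rintro n hn P rfl ℓ hℓ hheavy
  have hn0 : (0 : ℝ) < P.card := by exact_mod_cast (by omega : 0 < P.card)
  rcases card_le_or_ncard_inter_line_pow_le P hn ℓ hℓ with h | h
  · have h' : (P.card : ℝ) ≤ 16 * ({d : ℝ | ∃ p ∈ P, ∃ q ∈ P, p ≠ q ∧ d = dist p q}.ncard : ℝ) := by
      exact_mod_cast h
    refine (mul_le_mul_of_nonneg_right (min_le_left _ _) hn0.le).trans ?_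
    linarith
  · refine (mul_le_mul_of_nonneg_right (min_le_right _ _) hn0.le).trans ?_
    set D := {d : ℝ | ∃ p ∈ P, ∃ q ∈ P, p ≠ q ∧ d = dist p q}.ncard
    set M := ((P : Set (EuclideanSpace ℝ (Fin 2))) ∩ (ℓ : Set (EuclideanSpace ℝ (Fin 2)))).ncard
    have h' : (M : ℝ) ^ 8 ≤ 663552 * (2 * (D : ℝ)) ^ 7 := by exact_mod_cast h
    have h1 : (a * (P.card : ℝ) ^ ((7 : ℝ) / 8)) ^ 8 ≤ (M : ℝ) ^ 8 :=
      pow_le_pow_left₀ (by positivity) hheavy 8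
    have h2 : (((P.card : ℝ)) ^ ((7 : ℝ) / 8)) ^ 8 = (P.card : ℝ) ^ 7 := by
      rw [← Real.rpow_mul_natCast hn0.le, ← Real.rpow_natCast]
      norm_num
    have h3 : ((a ^ 8 / (663552 * 2 ^ 7)) ^ ((1 : ℝ) / 7)) ^ 7 = a ^ 8 / (663552 * 2 ^ 7) := by
      rw [← Real.rpow_mul_natCast (by positivity)]
      norm_num
    rw [mul_pow, h2] at h1
    refine le_of_pow_le_pow_left₀ (n := 7) (by norm_num) (Nat.cast_nonneg _) ?_
    rw [mul_pow, h3, div_mul_eq_mul_div, div_le_iff₀ (by positivity)]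
    calc _ ≤ 663552 * (2 * (D : ℝ)) ^ 7 := h1.trans h'
      _ = _ := by ring
end

section
/- For every a > 0 there exists b > 0 such that the following holds for all n ≥ 2: if P is a set of n points in ℝ² and there exists a circle C ⊂ ℝ² (the set of points at some fixed positive distance from a fixed center) containing at least a·n^{5/6} points of P, then P determines at least b·n distinct distances. (This is the quantitative form of: if D(P) = o(n), then no circle contains Ω(n^{5/6}) points of P.) -/
namespace HeavyCircle

open Finset ComplexConjugate

/-- The real-affine map `z ↦ α z + β z̄ + γ` of the complex plane. -/
noncomputable def affineMap (α β γ z : ℂ) : ℂ := α * z + β * conj z + γ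

lemma eq_zero_of_add_re_eq_zero {c R : ℝ} {κ z₁ z₂ z₃ : ℂ}
    (h₁ : ‖z₁‖ = R) (h₂ : ‖z₂‖ = R) (h₃ : ‖z₃‖ = R)
    (h₁₂ : z₁ ≠ z₂) (h₁₃ : z₁ ≠ z₃) (h₂₃ : z₂ ≠ z₃)
    (e₁ : c + (κ * z₁).re = 0) (e₂ : c + (κ * z₂).re = 0) (e₃ : c + (κ * z₃).re = 0) :
    κ = 0 ∧ c = 0 := by
  have key : ∀ z : ℂ, ‖z‖ = R → c + (κ * z).re = 0 →
      κ * z ^ 2 + 2 * c * z + conj κ * R ^ 2 = 0 := by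
    intro z hz e
    have h1 : κ * z + conj κ * conj z + 2 * c = 0 := by
      have := Complex.add_conj (κ * z)
      rw [map_mul] at this
      rw [this, show (κ * z).re = -c by linarith]
      push_cast; ring
    have h2 : z * conj z = (R : ℂ) ^ 2 := by rw [Complex.mul_conj', hz]
    linear_combination z * h1 - conj κ * h2
  have k₁ := key _ h₁ e₁
  have k₂ := key _ h₂ e₂
  have k₃ := key _ h₃ e₃
  have a : κ * (z₁ + z₂) + 2 * c = 0 :=
    mul_left_cancel₀ (sub_ne_zero.2 h₁₂) (by linear_combination k₁ - k₂)
  have b : κ * (z₁ + z₃) + 2 * c = 0 :=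
    mul_left_cancel₀ (sub_ne_zero.2 h₁₃) (by linear_combination k₁ - k₃)
  have hκ : κ = 0 :=
    mul_left_cancel₀ (sub_ne_zero.2 h₂₃) (by linear_combination a - b)
  refine ⟨hκ, ?_⟩
  simpa [hκ] using e₁

lemma exists_affineMap {z₁ z₂ z₃ : ℂ} (h₁ : ‖z₁‖ = 1) (h₂ : ‖z₂‖ = 1) (h₃ : ‖z₃‖ = 1)
    (h₁₂ : z₁ ≠ z₂) (h₁₃ : z₁ ≠ z₃) (h₂₃ : z₂ ≠ z₃) (w₁ w₂ w₃ : ℂ) :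
    ∃ α β γ, affineMap α β γ z₁ = w₁ ∧ affineMap α β γ z₂ = w₂ ∧ affineMap α β γ z₃ = w₃ := by
  have key : ∀ z : ℂ, ‖z‖ = 1 → conj z = z⁻¹ ∧ z ≠ 0 := by
    intro z hz
    have h0 : z ≠ 0 := by rintro rfl; simp at hz
    refine ⟨?_, h0⟩
    rw [Complex.inv_def, Complex.normSq_eq_norm_sq, hz]; simp
  obtain ⟨k₁, n₁⟩ := key _ h₁
  obtain ⟨k₂, n₂⟩ := key _ h₂
  obtain ⟨k₃, n₃⟩ := key _ h₃
  have d₁₂ : z₂ - z₁ ≠ 0 := sub_ne_zero.2 h₁₂.symm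
  have d₁₃ : z₃ - z₁ ≠ 0 := sub_ne_zero.2 h₁₃.symm
  have d₂₃ : z₃ - z₂ ≠ 0 := sub_ne_zero.2 h₂₃.symm
  let c₁ := (z₂ * w₂ - z₁ * w₁) / (z₂ - z₁)
  let c₂ := ((z₃ * w₃ - z₁ * w₁) / (z₃ - z₁) - c₁) / (z₃ - z₂)
  have e₁ : c₁ * (z₂ - z₁) = z₂ * w₂ - z₁ * w₁ := div_mul_cancel₀ _ d₁₂
  have e₂ : c₂ * (z₃ - z₂) * (z₃ - z₁) = z₃ * w₃ - z₁ * w₁ - c₁ * (z₃ - z₁) := by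
    simp only [c₂]; field_simp
  refine ⟨c₂, z₁ * w₁ - c₁ * z₁ + c₂ * z₁ * z₂, c₁ - c₂ * (z₁ + z₂), ?_, ?_, ?_⟩
  · rw [affineMap, k₁]
    apply mul_left_cancel₀ n₁
    field_simp; ring
  · rw [affineMap, k₂]
    apply mul_left_cancel₀ n₂
    field_simp; linear_combination e₁
  · rw [affineMap, k₃]
    apply mul_left_cancel₀ n₃
    field_simp; linear_combination e₂

lemma affineMap_degenerate {α β γ : ℂ} {S : Finset ℂ} (hS : ∀ z ∈ S, ‖z‖ = 1)
    (hT : ∀ z ∈ S, ‖affineMap α β γ z‖ = 1) (hc : 4 < #S) :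
    (α = 0 ∧ β = 0) ∨ (α = 0 ∧ γ = 0 ∧ ‖β‖ = 1) ∨ (β = 0 ∧ γ = 0 ∧ ‖α‖ = 1) := by
  let p : Polynomial ℂ := .C (α * conj β) * .X ^ 4 + .C (α * conj γ + γ * conj β) * .X ^ 3 +
    .C (α * conj α + β * conj β + γ * conj γ - 1) * .X ^ 2 +
    .C (γ * conj α + β * conj γ) * .X + .C (β * conj α)
  have hp : p = 0 := by
    refine Polynomial.eq_zero_of_natDegree_lt_card_of_eval_eq_zero' p S ?_ ?_
    · intro z hz
      have h1 : z * conj z = 1 := by rw [Complex.mul_conj', hS z hz]; simp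
      have h2 : affineMap α β γ z * conj (affineMap α β γ z) = 1 := by
        rw [Complex.mul_conj', hT z hz]; simp
      simp only [affineMap, map_add, map_mul, Complex.conj_conj] at h2
      simp only [p, Polynomial.eval_add, Polynomial.eval_mul, Polynomial.eval_C,
        Polynomial.eval_pow, Polynomial.eval_X]
      generalize conj z = v at *
      generalize conj α = a at *
      generalize conj β = b at *
      generalize conj γ = c at *
      linear_combination z ^ 2 * h2 + (-(z ^ 2 * (α * a + β * b)) - z * (γ * a + β * c)
        - β * a * (1 + z * v) ) * h1
    · refine lt_of_le_of_lt ?_ hc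
      simp only [p]; compute_degree
  have coeffs : ∀ a b c d e : ℂ, (.C a * .X ^ 4 + .C b * .X ^ 3 + .C c * .X ^ 2 + .C d * .X + .C e :
      Polynomial ℂ) = 0 → a = 0 ∧ b = 0 ∧ c = 0 := by
    intro a b c d e h
    have h4 := congrArg (fun f => Polynomial.coeff f 4) h
    have h3 := congrArg (fun f => Polynomial.coeff f 3) h
    have h2 := congrArg (fun f => Polynomial.coeff f 2) h
    simp only [Polynomial.coeff_add, Polynomial.coeff_C_mul, Polynomial.coeff_X_pow,
      Polynomial.coeff_X, Polynomial.coeff_C] at h4 h3 h2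
    norm_num at h4 h3 h2
    exact ⟨h4, h3, h2⟩
  obtain ⟨h4, h3, h2⟩ := coeffs _ _ _ _ _ hp
  rw [mul_eq_zero, map_eq_zero] at h4
  have nrm : ∀ x : ℂ, x * conj x - 1 = 0 → ‖x‖ = 1 := by
    intro x hx
    rw [Complex.mul_conj'] at hx
    have : ‖x‖ ^ 2 = 1 := by exact_mod_cast sub_eq_zero.1 hx
    nlinarith [norm_nonneg x]
  rcases h4 with rfl | rfl
  · by_cases hβ : β = 0
    · exact .inl ⟨rfl, hβ⟩
    · have hγ : γ = 0 := by simpa [hβ] using h3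
      subst hγ
      exact .inr (.inl ⟨rfl, rfl, nrm _ (by simpa using h2)⟩)
  · by_cases hα : α = 0
    · exact .inl ⟨hα, rfl⟩
    · have hγ : γ = 0 := by simpa [hα] using h3
      subst hγ
      exact .inr (.inr ⟨rfl, rfl, nrm _ (by simpa using h2)⟩)

lemma norm_sub_sq_of_norm_eq_one {p : ℂ} (hp : ‖p‖ = 1) (q : ℂ) :
    ‖p - q‖ ^ 2 = 1 + ‖q‖ ^ 2 - 2 * (conj q * p).re := by
  have hp' := congrArg (· ^ 2) hp
  simp only [← Complex.normSq_eq_norm_sq, Complex.normSq_apply] at *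
  simp only [Complex.mul_re, Complex.conj_re, Complex.conj_im, Complex.sub_re, Complex.sub_im]
  linear_combination hp'

lemma dist_eq_iff {p p' : ℂ} (hp : ‖p‖ = 1) (hp' : ‖p'‖ = 1) (q q' : ℂ) :
    ‖p - q‖ = ‖p' - q'‖ ↔
      (conj q * p).re - (conj q' * p').re = (‖q‖ ^ 2 - ‖q'‖ ^ 2) / 2 := by
  rw [← sq_eq_sq₀ (norm_nonneg _) (norm_nonneg _), norm_sub_sq_of_norm_eq_one hp,
    norm_sub_sq_of_norm_eq_one hp']
  constructor <;> intro h <;> linarith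

lemma conj_eq_of_affineMap {α β γ q q' z₁ z₂ z₃ : ℂ} {A : ℝ}
    (h₁ : ‖z₁‖ = 1) (h₂ : ‖z₂‖ = 1) (h₃ : ‖z₃‖ = 1)
    (h₁₂ : z₁ ≠ z₂) (h₁₃ : z₁ ≠ z₃) (h₂₃ : z₂ ≠ z₃)
    (e₁ : (conj q * z₁).re - (conj q' * affineMap α β γ z₁).re = A)
    (e₂ : (conj q * z₂).re - (conj q' * affineMap α β γ z₂).re = A)
    (e₃ : (conj q * z₃).re - (conj q' * affineMap α β γ z₃).re = A) :
    conj q = conj q' * α + q' * conj β ∧ (conj q' * γ).re = -A := by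
  have key : ∀ z : ℂ, (conj q * z).re - (conj q' * affineMap α β γ z).re = A →
      (-(conj q' * γ).re - A) + ((conj q - conj q' * α - q' * conj β) * z).re = 0 := by
    rintro z rfl
    simp only [affineMap, Complex.mul_re, Complex.mul_im, Complex.conj_re, Complex.conj_im,
      Complex.add_re, Complex.add_im, Complex.sub_re, Complex.sub_im]
    ring
  obtain ⟨hκ, hc⟩ := eq_zero_of_add_re_eq_zero h₁ h₂ h₃ h₁₂ h₁₃ h₂₃
    (key _ e₁) (key _ e₂) (key _ e₃)
  exact ⟨by linear_combination hκ, by linarith⟩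

lemma unique_of_affineMap {α β γ q q' s s' z₁ z₂ z₃ z₄ w : ℂ} {A B : ℝ}
    (h₁ : ‖z₁‖ = 1) (h₂ : ‖z₂‖ = 1) (h₃ : ‖z₃‖ = 1)
    (h₁₂ : z₁ ≠ z₂) (h₁₃ : z₁ ≠ z₃) (h₂₃ : z₂ ≠ z₃) (hw : affineMap α β γ z₄ ≠ w)
    (hA : A = (‖q‖ ^ 2 - ‖q'‖ ^ 2) / 2) (hB : B = (‖s‖ ^ 2 - ‖s'‖ ^ 2) / 2)
    (hA0 : A ≠ 0) (hB0 : B ≠ 0) (hq' : q' ≠ 0)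
    (e₁ : (conj q * z₁).re - (conj q' * affineMap α β γ z₁).re = A)
    (e₂ : (conj q * z₂).re - (conj q' * affineMap α β γ z₂).re = A)
    (e₃ : (conj q * z₃).re - (conj q' * affineMap α β γ z₃).re = A)
    (e₄ : (conj q * z₄).re - (conj q' * w).re = A)
    (f₁ : (conj s * z₁).re - (conj s' * affineMap α β γ z₁).re = B)
    (f₂ : (conj s * z₂).re - (conj s' * affineMap α β γ z₂).re = B)
    (f₃ : (conj s * z₃).re - (conj s' * affineMap α β γ z₃).re = B)
    (f₄ : (conj s * z₄).re - (conj s' * w).re = B) :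
    q = s ∧ q' = s' := by
  obtain ⟨a₁, a₂⟩ := conj_eq_of_affineMap h₁ h₂ h₃ h₁₂ h₁₃ h₂₃ e₁ e₂ e₃
  obtain ⟨b₁, b₂⟩ := conj_eq_of_affineMap h₁ h₂ h₃ h₁₂ h₁₃ h₂₃ f₁ f₂ f₃
  set d := w - affineMap α β γ z₄ with hd
  have hd0 : d ≠ 0 := sub_ne_zero.2 hw.symm
  have perp : ∀ (u u' : ℂ) (C : ℝ), conj u = conj u' * α + u' * conj β → (conj u' * γ).re = -C →
      (conj u * z₄).re - (conj u' * w).re = C → (conj u' * d).re = 0 := by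
    intro u u' C h h' h''
    rw [h] at h''
    simp only [hd, affineMap, Complex.mul_re, Complex.mul_im, Complex.conj_re, Complex.conj_im,
      Complex.add_re, Complex.add_im, Complex.sub_re, Complex.sub_im] at *
    linarith
  have pq := perp q q' A a₁ a₂ e₄
  have ps := perp s s' B b₁ b₂ f₄
  have im0 : (conj q' * d).im ≠ 0 := by
    intro h
    have : conj q' * d = 0 := Complex.ext pq h
    simp [hd0, hq'] at this
  set c : ℝ := (conj s' * d).im / (conj q' * d).im with hc
  have hs'c : conj s' = c * conj q' := by
    apply mul_right_cancel₀ hd0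
    have : conj s' * d = c * (conj q' * d) := by
      apply Complex.ext
      · rw [ps, Complex.re_ofReal_mul, pq, mul_zero]
      · rw [Complex.im_ofReal_mul, hc, div_mul_cancel₀ _ im0]
    rw [this]; ring
  have hs' : s' = c * q' := by
    have := congrArg conj hs'c
    simpa using this
  have hs : s = c * q := by
    have : conj s = c * conj q := by rw [b₁, a₁, hs'c, hs']; ring
    have := congrArg conj this
    simpa using this
  have hBA : B = c * A := by
    have : (conj s' * γ).re = c * (conj q' * γ).re := by
      rw [hs'c, mul_assoc, Complex.re_ofReal_mul]
    rw [b₂, a₂] at this; linarith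
  have hBA' : B = c ^ 2 * A := by
    rw [hB, hA, hs, hs', norm_mul, norm_mul, mul_pow, mul_pow, Complex.norm_real, Real.norm_eq_abs,
      sq_abs]
    ring
  have hc0 : c ≠ 0 := by rintro h; apply hB0; rw [hBA, h, zero_mul]
  have hc1 : c = 1 := by
    have : c * A * (c - 1) = 0 := by linarith [hBA.symm.trans hBA']
    simpa [hc0, hA0, sub_eq_zero] using this
  simp [hs, hs', hc1]

lemma card_affineMap_le {α β γ q q' z₁ z₂ z₃ : ℂ} {A : ℝ}
    (h₁ : ‖z₁‖ = 1) (h₂ : ‖z₂‖ = 1) (h₃ : ‖z₃‖ = 1)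
    (h₁₂ : z₁ ≠ z₂) (h₁₃ : z₁ ≠ z₃) (h₂₃ : z₂ ≠ z₃)
    (hq : q ≠ 0) (hqq' : ‖q‖ ≠ ‖q'‖)
    (e₁ : (conj q * z₁).re - (conj q' * affineMap α β γ z₁).re = A)
    (e₂ : (conj q * z₂).re - (conj q' * affineMap α β γ z₂).re = A)
    (e₃ : (conj q * z₃).re - (conj q' * affineMap α β γ z₃).re = A)
    {S : Finset ℂ} (hS : ∀ z ∈ S, ‖z‖ = 1) (hT : ∀ z ∈ S, ‖affineMap α β γ z‖ = 1) :
    #S ≤ 4 := by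
  by_contra! hc
  obtain ⟨hκ, -⟩ := conj_eq_of_affineMap h₁ h₂ h₃ h₁₂ h₁₃ h₂₃ e₁ e₂ e₃
  have hn := congrArg norm hκ
  rcases affineMap_degenerate hS hT hc with ⟨rfl, rfl⟩ | ⟨rfl, rfl, h⟩ | ⟨rfl, rfl, h⟩
  · simp [hq] at hκ
  · simp [h] at hn; exact hqq' hn
  · simp [h] at hn; exact hqq' hn

lemma card_le_two {c R : ℝ} {κ : ℂ} (hκ : κ ≠ 0) {S : Finset ℂ} (hS : ∀ z ∈ S, ‖z‖ = R)
    (he : ∀ z ∈ S, c + (κ * z).re = 0) : #S ≤ 2 := by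
  by_contra! h
  obtain ⟨x, hx, y, hy, z, hz, hxy, hxz, hyz⟩ := two_lt_card.1 h
  exact hκ (eq_zero_of_add_re_eq_zero (hS x hx) (hS y hy) (hS z hz) hxy hxz hyz
    (he x hx) (he y hy) (he z hz)).1

lemma re_lt_re {q p₁ p₂ : ℂ} (hq : q ≠ 0) (h₁ : ‖p₁‖ = 1) (h₂ : ‖p₂‖ = 1)
    (hc : 0 < (conj p₁ * p₂).im) (i₁ : 0 ≤ (conj q * p₁).im) (i₂ : 0 ≤ (conj q * p₂).im) :
    (conj q * p₂).re < (conj q * p₁).re := by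
  have n₁ := congrArg (· ^ 2) h₁
  have n₂ := congrArg (· ^ 2) h₂
  have nq : 0 < ‖q‖ ^ 2 := by positivity
  simp only [← Complex.normSq_eq_norm_sq, Complex.normSq_apply] at n₁ n₂ nq
  simp only [Complex.mul_re, Complex.mul_im, Complex.conj_re, Complex.conj_im] at *
  obtain ⟨a, b⟩ := q
  obtain ⟨x, y⟩ := p₁
  obtain ⟨u, v⟩ := p₂
  simp only at *
  have key : (1 + (x * u + y * v)) * ((a * x + b * y) - (a * u + b * v)) =
      ((a * y - b * x) + (a * v - b * u)) * (x * v - y * u) := by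
    linear_combination (a * u + b * v) * n₁ - (a * x + b * y) * n₂
  have hsum : 0 < (a * y - b * x) + (a * v - b * u) := by
    by_contra! hle
    have z₁ : a * y - b * x = 0 := by linarith
    have z₂ : a * v - b * u = 0 := by linarith
    have : (a * a + b * b) * (x * v - y * u) = 0 := by
      linear_combination (a * x + b * y) * z₂ - (a * u + b * v) * z₁
    have : 0 < (a * a + b * b) * (x * v - y * u) := mul_pos nq (by linarith)
    linarith
  have hpos : 0 ≤ 1 + (x * u + y * v) := by
    nlinarith [sq_nonneg (x + u), sq_nonneg (y + v)]
  have : 0 < (1 + (x * u + y * v)) * ((a * x + b * y) - (a * u + b * v)) := by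
    rw [key]; exact mul_pos hsum (by linarith)
  have := pos_of_mul_pos_right this hpos
  linarith

lemma re_lt_re' {q p₁ p₂ : ℂ} (hq : q ≠ 0) (h₁ : ‖p₁‖ = 1) (h₂ : ‖p₂‖ = 1)
    (hc : 0 < (conj p₁ * p₂).im) (i₁ : (conj q * p₁).im ≤ 0) (i₂ : (conj q * p₂).im ≤ 0) :
    (conj q * p₁).re < (conj q * p₂).re := by
  have := re_lt_re (q := -q) (neg_ne_zero.2 hq) h₁ h₂ hc (by simpa using i₁) (by simpa using i₂)
  rwa [map_neg, neg_mul, neg_mul, Complex.neg_re, Complex.neg_re, neg_lt_neg_iff] at this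

/-- A pair of points `x` and a pair of centres `w` spanning equal distances. -/
def OnCurve (w x : ℂ × ℂ) : Prop := ‖x.1 - w.1‖ = ‖x.2 - w.2‖

/-- The pairs of centres that are nonzero and lie at different distances from the origin. -/
def Nondegenerate (w : ℂ × ℂ) : Prop := w.1 ≠ 0 ∧ w.2 ≠ 0 ∧ ‖w.1‖ ≠ ‖w.2‖

/-- Four pairs, three of which have distinct first coordinates, that do not lie on the graph of a
single real-affine map. -/
def Determining (τ : (ℂ × ℂ) × (ℂ × ℂ) × (ℂ × ℂ) × (ℂ × ℂ)) : Prop :=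
  τ.1.1 ≠ τ.2.1.1 ∧ τ.1.1 ≠ τ.2.2.1.1 ∧ τ.2.1.1 ≠ τ.2.2.1.1 ∧
  ∃ α β γ, affineMap α β γ τ.1.1 = τ.1.2 ∧ affineMap α β γ τ.2.1.1 = τ.2.1.2 ∧
    affineMap α β γ τ.2.2.1.1 = τ.2.2.1.2 ∧ affineMap α β γ τ.2.2.2.1 ≠ τ.2.2.2.2

/-- The pairs of points on the unit circle. -/
def OnTorus (x : ℂ × ℂ) : Prop := ‖x.1‖ = 1 ∧ ‖x.2‖ = 1

lemma OnCurve.eq {w x : ℂ × ℂ} (h : OnCurve w x) (hx : OnTorus x) :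
    (conj w.1 * x.1).re - (conj w.2 * x.2).re = (‖w.1‖ ^ 2 - ‖w.2‖ ^ 2) / 2 :=
  (dist_eq_iff hx.1 hx.2 _ _).1 h

lemma Nondegenerate.sub_ne_zero {w : ℂ × ℂ} (h : Nondegenerate w) :
    (‖w.1‖ ^ 2 - ‖w.2‖ ^ 2) / 2 ≠ 0 := by
  intro h0
  exact h.2.2 ((sq_eq_sq₀ (norm_nonneg _) (norm_nonneg _)).1 (by linarith))

lemma Determining.unique {τ : (ℂ × ℂ) × (ℂ × ℂ) × (ℂ × ℂ) × (ℂ × ℂ)} (hτ : Determining τ)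
    (t₁ : OnTorus τ.1) (t₂ : OnTorus τ.2.1) (t₃ : OnTorus τ.2.2.1) (t₄ : OnTorus τ.2.2.2)
    {w v : ℂ × ℂ} (hw : Nondegenerate w) (hv : Nondegenerate v)
    (w₁ : OnCurve w τ.1) (w₂ : OnCurve w τ.2.1) (w₃ : OnCurve w τ.2.2.1) (w₄ : OnCurve w τ.2.2.2)
    (v₁ : OnCurve v τ.1) (v₂ : OnCurve v τ.2.1) (v₃ : OnCurve v τ.2.2.1)
    (v₄ : OnCurve v τ.2.2.2) : w = v := by
  obtain ⟨h₁₂, h₁₃, h₂₃, α, β, γ, e₁, e₂, e₃, e₄⟩ := hτ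
  have := unique_of_affineMap t₁.1 t₂.1 t₃.1 h₁₂ h₁₃ h₂₃ e₄ rfl rfl hw.sub_ne_zero hv.sub_ne_zero
    hw.2.1 (e₁ ▸ w₁.eq t₁) (e₂ ▸ w₂.eq t₂) (e₃ ▸ w₃.eq t₃) (w₄.eq t₄)
    (e₁ ▸ v₁.eq t₁) (e₂ ▸ v₂.eq t₂) (e₃ ▸ v₃.eq t₃) (v₄.eq t₄)
  exact Prod.ext this.1 this.2

open Classical in
lemma card_le_add_card_determining {X : Finset (ℂ × ℂ)} {w : ℂ × ℂ} (hw : Nondegenerate w)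
    (ht : ∀ x ∈ X, OnTorus x) (hX : ∀ x ∈ X, OnCurve w x) :
    #X ≤ 4 + #{τ ∈ X ×ˢ X ×ˢ X ×ˢ X | Determining τ} := by
  by_cases hcard : #X ≤ 4
  · omega
  have himg : 2 < #(X.image Prod.fst) := by
    have : #X ≤ 2 * #(X.image Prod.fst) := by
      refine card_le_mul_card_image _ _ fun p hp => ?_
      rw [← card_image_of_injOn (f := Prod.snd)]
      · refine card_le_two (c := (‖w.1‖ ^ 2 - ‖w.2‖ ^ 2) / 2 - (conj w.1 * p).re) (R := 1)
          (κ := conj w.2) (by simpa using hw.2.1) ?_ ?_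
        · simp only [mem_image, mem_filter]
          rintro _ ⟨x, ⟨hx, -⟩, rfl⟩
          exact (ht x hx).2
        · simp only [mem_image, mem_filter]
          rintro _ ⟨x, ⟨hx, rfl⟩, rfl⟩
          linarith [(hX x hx).eq (ht x hx)]
      · intro x hx y hy h
        simp only [coe_filter, Set.mem_ofPred_eq] at hx hy
        exact Prod.ext (hx.2.trans hy.2.symm) h
    omega
  obtain ⟨p₁, hp₁, p₂, hp₂, p₃, hp₃, h₁₂, h₁₃, h₂₃⟩ := two_lt_card.1 himg
  simp only [mem_image] at hp₁ hp₂ hp₃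
  obtain ⟨x₁, hx₁, rfl⟩ := hp₁
  obtain ⟨x₂, hx₂, rfl⟩ := hp₂
  obtain ⟨x₃, hx₃, rfl⟩ := hp₃
  obtain ⟨α, β, γ, e₁, e₂, e₃⟩ := exists_affineMap (ht _ hx₁).1 (ht _ hx₂).1 (ht _ hx₃).1
    h₁₂ h₁₃ h₂₃ x₁.2 x₂.2 x₃.2
  rw [← card_filter_add_card_filter_not (s := X) (fun x => affineMap α β γ x.1 = x.2)]
  refine Nat.add_le_add ?_ ?_
  · rw [← card_image_of_injOn (f := Prod.fst)]
    · refine card_affineMap_le (α := α) (β := β) (γ := γ) (ht _ hx₁).1 (ht _ hx₂).1 (ht _ hx₃).1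
        h₁₂ h₁₃ h₂₃ hw.1 hw.2.2 (e₁ ▸ (hX _ hx₁).eq (ht _ hx₁)) (e₂ ▸ (hX _ hx₂).eq (ht _ hx₂))
        (e₃ ▸ (hX _ hx₃).eq (ht _ hx₃)) ?_ ?_
      · simp only [mem_image, mem_filter]
        rintro _ ⟨x, ⟨hx, -⟩, rfl⟩
        exact (ht x hx).1
      · simp only [mem_image, mem_filter]
        rintro _ ⟨x, ⟨hx, h⟩, rfl⟩
        rw [h]
        exact (ht x hx).2
    · intro x hx y hy h
      simp only [coe_filter, Set.mem_ofPred_eq] at hx hy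
      exact Prod.ext h (by rw [← hx.2, ← hy.2, h])
  · refine card_le_card_of_injOn (fun x => (x₁, x₂, x₃, x)) ?_ ?_
    · intro x hx
      simp only [coe_filter, Set.mem_ofPred_eq] at hx
      simp only [coe_filter, mem_product, Set.mem_ofPred_eq]
      exact ⟨⟨hx₁, hx₂, hx₃, hx.1⟩, h₁₂, h₁₃, h₂₃, α, β, γ, e₁, e₂, e₃, hx.2⟩
    · intro x _ y _ h
      simpa using h

lemma card_le_of_monotone {t : ℕ} {S : Finset (ℕ × ℕ)} (ht : ∀ x ∈ S, x.1 < t ∧ x.2 < t)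
    (h : ∀ x ∈ S, ∀ y ∈ S, x.1 < y.1 → x.2 ≤ y.2) : #S ≤ 2 * t := by
  rw [← card_range (2 * t)]
  refine card_le_card_of_injOn (fun x => x.1 + x.2) ?_ ?_
  · intro x hx
    have := ht x hx
    simp only [coe_range, Set.mem_Iio]
    omega
  · intro x hx y hy hxy
    simp only at hxy
    have h₁ := h x hx y hy
    have h₂ := h y hy x hx
    ext <;> omega

lemma card_le_of_antitone {t : ℕ} {S : Finset (ℕ × ℕ)} (ht : ∀ x ∈ S, x.1 < t ∧ x.2 < t)
    (h : ∀ x ∈ S, ∀ y ∈ S, x.1 < y.1 → y.2 ≤ x.2) : #S ≤ 2 * t := by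
  rw [← card_range (2 * t)]
  refine card_le_card_of_injOn (fun x => x.1 + (t - x.2)) ?_ ?_
  · intro x hx
    have := ht x hx
    simp only [coe_range, Set.mem_Iio]
    omega
  · intro x hx y hy hxy
    simp only at hxy
    have h₁ := h x hx y hy
    have h₂ := h y hy x hx
    have := ht x hx
    have := ht y hy
    ext <;> omega

open Classical in
lemma card_cells_le {X : Finset (ℂ × ℂ)} {w : ℂ × ℂ} (hw : Nondegenerate w)
    (ht : ∀ x ∈ X, OnTorus x) (hX : ∀ x ∈ X, OnCurve w x) {Z : Finset ℂ}
    (hZ : ∀ x ∈ X, x.1 ∈ Z ∧ x.2 ∈ Z) {t : ℕ} {c : ℂ → ℕ} (hct : ∀ z ∈ Z, c z < t)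
    (hc : ∀ z ∈ Z, ∀ z' ∈ Z, c z < c z' → 0 < (conj z * z').im) :
    #(X.image fun x => (c x.1, c x.2)) ≤ 8 * t := by
  have bd : ∀ Y ⊆ X, ∀ x ∈ Y.image (fun x => (c x.1, c x.2)), x.1 < t ∧ x.2 < t := by
    intro Y hY x hx
    obtain ⟨y, hy, rfl⟩ := mem_image.1 hx
    exact ⟨hct _ (hZ y (hY hy)).1, hct _ (hZ y (hY hy)).2⟩
  let P₁ : ℂ × ℂ → Prop := fun x => 0 ≤ (conj w.1 * x.1).im ∧ 0 ≤ (conj w.2 * x.2).im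
  let P₂ : ℂ × ℂ → Prop := fun x => 0 ≤ (conj w.1 * x.1).im ∧ (conj w.2 * x.2).im ≤ 0
  let P₃ : ℂ × ℂ → Prop := fun x => (conj w.1 * x.1).im ≤ 0 ∧ 0 ≤ (conj w.2 * x.2).im
  let P₄ : ℂ × ℂ → Prop := fun x => (conj w.1 * x.1).im ≤ 0 ∧ (conj w.2 * x.2).im ≤ 0
  have hcover : X = ((X.filter P₁ ∪ X.filter P₂) ∪ X.filter P₃) ∪ X.filter P₄ := by
    ext x
    have hx : P₁ x ∨ P₂ x ∨ P₃ x ∨ P₄ x := by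
      rcases le_total 0 (conj w.1 * x.1).im with h₁ | h₁ <;>
        rcases le_total 0 (conj w.2 * x.2).im with h₂ | h₂
      · exact .inl ⟨h₁, h₂⟩
      · exact .inr (.inl ⟨h₁, h₂⟩)
      · exact .inr (.inr (.inl ⟨h₁, h₂⟩))
      · exact .inr (.inr (.inr ⟨h₁, h₂⟩))
    simp only [← filter_or, mem_filter, or_assoc, hx, and_true]
  have b₁ : #((X.filter P₁).image fun x => (c x.1, c x.2)) ≤ 2 * t := by
    refine card_le_of_monotone (bd _ (filter_subset _ _)) ?_
    simp only [mem_image, mem_filter]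
    rintro _ ⟨x, ⟨hx, hx₁, hx₂⟩, rfl⟩ _ ⟨y, ⟨hy, hy₁, hy₂⟩, rfl⟩ hlt
    by_contra! hgt
    have := re_lt_re hw.1 (ht x hx).1 (ht y hy).1 (hc _ (hZ x hx).1 _ (hZ y hy).1 hlt) hx₁ hy₁
    have := re_lt_re hw.2.1 (ht y hy).2 (ht x hx).2 (hc _ (hZ y hy).2 _ (hZ x hx).2 hgt) hy₂ hx₂
    linarith [(hX x hx).eq (ht x hx), (hX y hy).eq (ht y hy)]
  have b₂ : #((X.filter P₂).image fun x => (c x.1, c x.2)) ≤ 2 * t := by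
    refine card_le_of_antitone (bd _ (filter_subset _ _)) ?_
    simp only [mem_image, mem_filter]
    rintro _ ⟨x, ⟨hx, hx₁, hx₂⟩, rfl⟩ _ ⟨y, ⟨hy, hy₁, hy₂⟩, rfl⟩ hlt
    by_contra! hgt
    have := re_lt_re hw.1 (ht x hx).1 (ht y hy).1 (hc _ (hZ x hx).1 _ (hZ y hy).1 hlt) hx₁ hy₁
    have := re_lt_re' hw.2.1 (ht x hx).2 (ht y hy).2 (hc _ (hZ x hx).2 _ (hZ y hy).2 hgt) hx₂ hy₂
    linarith [(hX x hx).eq (ht x hx), (hX y hy).eq (ht y hy)]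
  have b₃ : #((X.filter P₃).image fun x => (c x.1, c x.2)) ≤ 2 * t := by
    refine card_le_of_antitone (bd _ (filter_subset _ _)) ?_
    simp only [mem_image, mem_filter]
    rintro _ ⟨x, ⟨hx, hx₁, hx₂⟩, rfl⟩ _ ⟨y, ⟨hy, hy₁, hy₂⟩, rfl⟩ hlt
    by_contra! hgt
    have := re_lt_re' hw.1 (ht x hx).1 (ht y hy).1 (hc _ (hZ x hx).1 _ (hZ y hy).1 hlt) hx₁ hy₁
    have := re_lt_re hw.2.1 (ht x hx).2 (ht y hy).2 (hc _ (hZ x hx).2 _ (hZ y hy).2 hgt) hx₂ hy₂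
    linarith [(hX x hx).eq (ht x hx), (hX y hy).eq (ht y hy)]
  have b₄ : #((X.filter P₄).image fun x => (c x.1, c x.2)) ≤ 2 * t := by
    refine card_le_of_monotone (bd _ (filter_subset _ _)) ?_
    simp only [mem_image, mem_filter]
    rintro _ ⟨x, ⟨hx, hx₁, hx₂⟩, rfl⟩ _ ⟨y, ⟨hy, hy₁, hy₂⟩, rfl⟩ hlt
    by_contra! hgt
    have := re_lt_re' hw.1 (ht x hx).1 (ht y hy).1 (hc _ (hZ x hx).1 _ (hZ y hy).1 hlt) hx₁ hy₁
    have := re_lt_re' hw.2.1 (ht y hy).2 (ht x hx).2 (hc _ (hZ y hy).2 _ (hZ x hx).2 hgt) hy₂ hx₂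
    linarith [(hX x hx).eq (ht x hx), (hX y hy).eq (ht y hy)]
  rw [hcover, image_union, image_union, image_union]
  refine (card_union_le _ _).trans ?_
  have := card_union_le (image (fun x => (c x.1, c x.2)) (X.filter P₁) ∪
    image (fun x => (c x.1, c x.2)) (X.filter P₂)) (image (fun x => (c x.1, c x.2)) (X.filter P₃))
  have := card_union_le (image (fun x => (c x.1, c x.2)) (X.filter P₁))
    (image (fun x => (c x.1, c x.2)) (X.filter P₂))
  omega

lemma card_nondegenerate_le {Z W : Finset ℂ} (hZ : ∀ z ∈ Z, ‖z‖ = 1) {t M : ℕ} {c : ℂ → ℕ}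
    (hct : ∀ z ∈ Z, c z < t) (hc : ∀ z ∈ Z, ∀ z' ∈ Z, c z < c z' → 0 < (conj z * z').im)
    (hM : ∀ i, #{z ∈ Z | c z = i} ≤ M) [DecidablePred Nondegenerate]
    [∀ w, DecidablePred (OnCurve w)] :
    ∑ w ∈ (W ×ˢ W).filter Nondegenerate, #((Z ×ˢ Z).filter (OnCurve w)) ≤
      32 * t * #W ^ 2 + t ^ 2 * M ^ 8 := by
  classical
  let cell : ℂ × ℂ → ℕ × ℕ := fun x => (c x.1, c x.2)
  let B : ℕ × ℕ → Finset (ℂ × ℂ) := fun i => {x ∈ Z ×ˢ Z | cell x = i}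
  let T := (range t ×ˢ range t).biUnion fun i => (B i ×ˢ B i ×ˢ B i ×ˢ B i).filter Determining
  let On : ℂ × ℂ → (ℂ × ℂ) × (ℂ × ℂ) × (ℂ × ℂ) × (ℂ × ℂ) → Prop := fun w τ =>
    OnCurve w τ.1 ∧ OnCurve w τ.2.1 ∧ OnCurve w τ.2.2.1 ∧ OnCurve w τ.2.2.2
  have htorus : ∀ x ∈ Z ×ˢ Z, OnTorus x := fun x hx =>
    ⟨hZ _ (mem_product.1 hx).1, hZ _ (mem_product.1 hx).2⟩
  have hT : #T ≤ t ^ 2 * M ^ 8 := by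
    refine (card_biUnion_le_card_mul _ _ (M ^ 8) fun i _ => ?_).trans_eq ?_
    · have hB : #(B i) ≤ M ^ 2 := by
        have : B i = {z ∈ Z | c z = i.1} ×ˢ {z ∈ Z | c z = i.2} := by
          ext x
          simp only [B, cell, mem_filter, mem_product, Prod.ext_iff]
          tauto
        rw [this, card_product, sq]
        exact Nat.mul_le_mul (hM _) (hM _)
      refine (card_filter_le _ _).trans ?_
      simp only [card_product]
      calc #(B i) * (#(B i) * (#(B i) * #(B i))) = #(B i) ^ 4 := by ring
        _ ≤ (M ^ 2) ^ 4 := Nat.pow_le_pow_left hB 4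
        _ = M ^ 8 := by ring
    · rw [card_product, card_range]; ring
  have hcurve : ∀ w ∈ (W ×ˢ W).filter Nondegenerate,
      #((Z ×ˢ Z).filter (OnCurve w)) ≤ 32 * t + #{τ ∈ T | On w τ} := by
    intro w hw
    have hw := (mem_filter.1 hw).2
    set X := (Z ×ˢ Z).filter (OnCurve w) with hXdef
    have hXZ : ∀ x ∈ X, x ∈ Z ×ˢ Z := fun x hx => (mem_filter.1 hx).1
    have hXt : ∀ x ∈ X, OnTorus x := fun x hx => htorus x (hXZ x hx)
    have hXc : ∀ x ∈ X, OnCurve w x := fun x hx => (mem_filter.1 hx).2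
    have hcells : #(X.image cell) ≤ 8 * t :=
      card_cells_le hw hXt hXc (fun x hx => mem_product.1 (hXZ x hx)) hct hc
    calc #X = ∑ i ∈ X.image cell, #{x ∈ X | cell x = i} := card_eq_sum_card_image _ _
      _ ≤ ∑ i ∈ X.image cell, (4 + #{τ ∈ {τ ∈ T | On w τ} | cell τ.1 = i}) := by
        refine sum_le_sum fun i hi => ?_
        refine (card_le_add_card_determining hw (fun x hx => hXt x (mem_filter.1 hx).1)
          (fun x hx => hXc x (mem_filter.1 hx).1)).trans (Nat.add_le_add_left ?_ _)
        refine card_le_card fun τ hτ => ?_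
        obtain ⟨hτ, hdet⟩ := mem_filter.1 hτ
        simp only [mem_product, mem_filter] at hτ
        obtain ⟨⟨h₁, i₁⟩, ⟨h₂, i₂⟩, ⟨h₃, i₃⟩, ⟨h₄, i₄⟩⟩ := hτ
        refine mem_filter.2 ⟨mem_filter.2 ⟨mem_biUnion.2 ⟨i, ?_, ?_⟩, hXc _ h₁, hXc _ h₂,
          hXc _ h₃, hXc _ h₄⟩, i₁⟩
        · obtain ⟨x, hx, rfl⟩ := mem_image.1 hi
          have := mem_product.1 (hXZ x hx)
          exact mem_product.2 ⟨mem_range.2 (hct _ this.1), mem_range.2 (hct _ this.2)⟩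
        · refine mem_filter.2 ⟨?_, hdet⟩
          simp only [mem_product, B, mem_filter]
          exact ⟨⟨mem_product.1 (hXZ _ h₁), i₁⟩, ⟨mem_product.1 (hXZ _ h₂), i₂⟩,
            ⟨mem_product.1 (hXZ _ h₃), i₃⟩, ⟨mem_product.1 (hXZ _ h₄), i₄⟩⟩
      _ = #(X.image cell) * 4 + ∑ i ∈ X.image cell, #{τ ∈ {τ ∈ T | On w τ} | cell τ.1 = i} := by
        rw [sum_add_distrib, sum_const, smul_eq_mul]
      _ ≤ 32 * t + #{τ ∈ T | On w τ} := by
        refine Nat.add_le_add (by omega) ?_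
        rw [sum_card_fiberwise_eq_card_filter]
        exact card_filter_le _ _
  have huniq : ∀ τ ∈ T, #{w ∈ (W ×ˢ W).filter Nondegenerate | On w τ} ≤ 1 := by
    intro τ hτ
    rw [card_le_one]
    intro w hw v hv
    obtain ⟨i, -, hi⟩ := mem_biUnion.1 hτ
    obtain ⟨hi, hdet⟩ := mem_filter.1 hi
    simp only [mem_product (s := B _), B, mem_filter] at hi
    obtain ⟨hw, w₁, w₂, w₃, w₄⟩ := mem_filter.1 hw
    obtain ⟨hv, v₁, v₂, v₃, v₄⟩ := mem_filter.1 hv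
    exact hdet.unique (htorus _ hi.1.1) (htorus _ hi.2.1.1) (htorus _ hi.2.2.1.1)
      (htorus _ hi.2.2.2.1) (mem_filter.1 hw).2 (mem_filter.1 hv).2 w₁ w₂ w₃ w₄ v₁ v₂ v₃ v₄
  calc ∑ w ∈ (W ×ˢ W).filter Nondegenerate, #((Z ×ˢ Z).filter (OnCurve w))
      ≤ ∑ w ∈ (W ×ˢ W).filter Nondegenerate, (32 * t + #{τ ∈ T | On w τ}) := sum_le_sum hcurve
    _ = #((W ×ˢ W).filter Nondegenerate) * (32 * t) +
          ∑ τ ∈ T, #{w ∈ (W ×ˢ W).filter Nondegenerate | On w τ} := by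
        rw [sum_add_distrib, sum_const, smul_eq_mul]
        congr 1
        exact sum_card_bipartiteAbove_eq_sum_card_bipartiteBelow On
    _ ≤ #W ^ 2 * (32 * t) + #T * 1 := by
        refine Nat.add_le_add (Nat.mul_le_mul_right _ ?_) (sum_le_card_nsmul _ _ _ huniq)
        rw [sq, ← card_product]
        exact card_filter_le _ _
    _ ≤ 32 * t * #W ^ 2 + t ^ 2 * M ^ 8 := by
        have : #W ^ 2 * (32 * t) = 32 * t * #W ^ 2 := by ring
        omega

open Classical in
lemma card_norm_eq_le {Z W : Finset ℂ} (hZ : ∀ z ∈ Z, ‖z‖ = 1) :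
    #{y ∈ (W ×ˢ W) ×ˢ (Z ×ˢ Z) | ‖y.1.1‖ = ‖y.1.2‖ ∧ OnCurve y.1 y.2} ≤ 2 * (#W * #Z ^ 2) := by
  refine (card_le_mul_card_image (f := fun y => (y.1.1, y.2)) _ 2 ?_).trans ?_
  · rintro ⟨q, p, p'⟩ hy
    have hp : ‖p‖ = 1 ∧ ‖p'‖ = 1 := by
      simp only [mem_image, mem_filter, mem_product, Prod.mk.injEq] at hy
      obtain ⟨y, ⟨⟨-, h₁, h₂⟩, -⟩, -, h⟩ := hy
      rw [h] at h₁ h₂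
      exact ⟨hZ _ h₁, hZ _ h₂⟩
    rw [← card_image_of_injOn (f := fun y => y.1.2)]
    · refine card_le_two (c := -(conj q * p).re) (R := ‖q‖) (κ := conj p')
        (by rw [ne_eq, map_eq_zero]; rintro rfl; simp at hp) ?_ ?_
      · simp only [mem_image, mem_filter, Prod.mk.injEq]
        rintro _ ⟨y, ⟨⟨-, h, -⟩, rfl, -⟩, rfl⟩
        exact h.symm
      · simp only [mem_image, mem_filter, Prod.mk.injEq]
        rintro _ ⟨⟨⟨q, q'⟩, y⟩, ⟨⟨-, h, h'⟩, rfl, rfl⟩, rfl⟩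
        have := h'.eq hp
        simp only at this h ⊢
        rw [h, sub_self, zero_div] at this
        simp only [Complex.mul_re, Complex.conj_re, Complex.conj_im] at *
        linarith
    · rintro ⟨⟨a, b⟩, x⟩ hx ⟨⟨a', b'⟩, x'⟩ hx' h
      simp only [coe_filter, Set.mem_ofPred_eq, Prod.mk.injEq] at hx hx' h ⊢
      exact ⟨⟨hx.2.1.trans hx'.2.1.symm, h⟩, hx.2.2.trans hx'.2.2.symm⟩
  · refine Nat.mul_le_mul_left _ ?_
    rw [sq, ← card_product, ← card_product]
    refine card_le_card fun x hx => ?_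
    simp only [mem_image, mem_filter, mem_product] at hx ⊢
    obtain ⟨y, ⟨⟨h₁, h₂⟩, -⟩, rfl⟩ := hx
    exact ⟨h₁.1, h₂⟩

lemma card_sq_le_card_image_mul {ι κ : Type*} [DecidableEq κ] (s : Finset ι) (f : ι → κ) :
    #s ^ 2 ≤ #(s.image f) * #{x ∈ s ×ˢ s | f x.1 = f x.2} := by
  classical
  calc #s ^ 2 = (∑ d ∈ s.image f, #{x ∈ s | f x = d}) ^ 2 := by rw [← card_eq_sum_card_image]
    _ ≤ #(s.image f) * ∑ d ∈ s.image f, #{x ∈ s | f x = d} ^ 2 := sq_sum_le_card_mul_sum_sq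
    _ ≤ #(s.image f) * ∑ d ∈ s.image f, #{x ∈ {x ∈ s ×ˢ s | f x.1 = f x.2} | f x.1 = d} := by
      refine Nat.mul_le_mul_left _ (sum_le_sum fun d _ => ?_)
      rw [sq, ← card_product]
      refine card_le_card fun x hx => ?_
      simp only [mem_product, mem_filter] at hx ⊢
      exact ⟨⟨⟨hx.1.1, hx.2.1⟩, hx.1.2.trans hx.2.2.symm⟩, hx.1.2⟩
    _ ≤ #(s.image f) * #{x ∈ s ×ˢ s | f x.1 = f x.2} := by
      rw [sum_card_fiberwise_eq_card_filter]
      exact Nat.mul_le_mul_left _ (card_filter_le _ _)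

lemma exists_cells {Z : Finset ℂ} (hZ : ∀ z ∈ Z, ‖z‖ = 1)
    (harg : (∀ z ∈ Z, 0 < z.arg) ∨ (∀ z ∈ Z, z.arg ≤ 0)) {t M : ℕ} (hM : 0 < M)
    (htM : #Z ≤ t * M) :
    ∃ c : ℂ → ℕ, (∀ z ∈ Z, c z < t) ∧
      (∀ z ∈ Z, ∀ z' ∈ Z, c z < c z' → 0 < (conj z * z').im) ∧
      ∀ i, #{z ∈ Z | c z = i} ≤ M := by
  let rank : ℂ → ℕ := fun z => #{w ∈ Z | w.arg < z.arg}
  have rank_lt : ∀ z ∈ Z, rank z < #Z := fun z hz =>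
    card_lt_card (filter_ssubset.2 ⟨z, hz, lt_irrefl _⟩)
  have rank_mono : ∀ z z' : ℂ, z.arg ≤ z'.arg → rank z ≤ rank z' := by
    intro z z' h
    refine card_le_card fun w hw => ?_
    simp only [mem_filter] at hw ⊢
    exact ⟨hw.1, hw.2.trans_le h⟩
  have rank_strict : ∀ z ∈ Z, ∀ z' : ℂ, z.arg < z'.arg → rank z < rank z' := by
    intro z hz z' h
    refine card_lt_card ((ssubset_iff_of_subset fun w hw => ?_).2 ⟨z, ?_, ?_⟩)
    · simp only [mem_filter] at hw ⊢
      exact ⟨hw.1, hw.2.trans h⟩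
    · simp [hz, h]
    · simp
  have rank_inj : ∀ z ∈ Z, ∀ z' ∈ Z, rank z = rank z' → z = z' := by
    intro z hz z' hz' h
    apply Complex.ext_norm_arg (by rw [hZ z hz, hZ z' hz'])
    rcases lt_trichotomy z.arg z'.arg with h' | h' | h'
    · exact absurd h (rank_strict z hz z' h').ne
    · exact h'
    · exact absurd h (rank_strict z' hz' z h').ne'
  refine ⟨fun z => rank z / M, ?_, ?_, ?_⟩
  · intro z hz
    exact (Nat.div_lt_iff_lt_mul hM).2 ((rank_lt z hz).trans_le htM)
  · intro z hz z' hz' h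
    have hlt : z.arg < z'.arg := by
      by_contra! hle
      exact absurd (Nat.div_le_div_right (c := M) (rank_mono z' z hle)) (not_le.2 h)
    have him : (conj z * z').im = Real.sin (z'.arg - z.arg) := by
      have h0 : z ≠ 0 := by rintro rfl; simpa using hZ 0 hz
      have h0' : z' ≠ 0 := by rintro rfl; simpa using hZ 0 hz'
      rw [Real.sin_sub, Complex.sin_arg, Complex.sin_arg, Complex.cos_arg h0, Complex.cos_arg h0',
        hZ z hz, hZ z' hz']
      simp only [Complex.mul_im, Complex.conj_re, Complex.conj_im]
      ring
    rw [him]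
    have := Complex.arg_le_pi z'
    have := Complex.neg_pi_lt_arg z
    rcases harg with harg | harg <;>
    · have := harg z hz
      have := harg z' hz'
      apply Real.sin_pos_of_pos_of_lt_pi <;> linarith
  · intro i
    rw [← card_image_of_injOn (f := rank)]
    · calc _ ≤ #(Ico (i * M) (i * M + M)) := by
            refine card_le_card fun r hr => ?_
            simp only [mem_image, mem_filter, mem_Ico] at hr ⊢
            obtain ⟨z, ⟨-, rfl⟩, rfl⟩ := hr
            exact ⟨Nat.div_mul_le_self _ _, by
              have := Nat.lt_div_mul_add (a := rank z) hM; omega⟩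
        _ = M := by simp
    · intro z hz z' hz' h
      simp only [coe_filter, Set.mem_ofPred_eq] at hz hz'
      exact rank_inj z hz.1 z' hz'.1 h

lemma card_mul_card_sq_le {Z W : Finset ℂ} (hZ : ∀ z ∈ Z, ‖z‖ = 1)
    (harg : (∀ z ∈ Z, 0 < z.arg) ∨ (∀ z ∈ Z, z.arg ≤ 0)) (hW : ∀ w ∈ W, w ≠ 0)
    {t M : ℕ} (hM : 0 < M) (htM : #Z ≤ t * M) :
    (#Z * #W) ^ 2 ≤ #((Z ×ˢ W).image fun x => ‖x.1 - x.2‖) *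
      (2 * (#W * #Z ^ 2) + 32 * t * #W ^ 2 + t ^ 2 * M ^ 8) := by
  classical
  obtain ⟨c, hct, hc, hcM⟩ := exists_cells hZ harg hM htM
  rw [← card_product]
  refine (card_sq_le_card_image_mul _ _).trans (Nat.mul_le_mul_left _ ?_)
  calc _ ≤ #{y ∈ (W ×ˢ W) ×ˢ (Z ×ˢ Z) | OnCurve y.1 y.2} := by
        refine card_le_card_of_injOn (fun x => ((x.1.2, x.2.2), (x.1.1, x.2.1))) ?_ ?_
        · intro x hx
          simp only [coe_filter, Set.mem_ofPred_eq, mem_product] at hx ⊢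
          exact ⟨⟨⟨hx.1.1.2, hx.1.2.2⟩, hx.1.1.1, hx.1.2.1⟩, hx.2⟩
        · rintro ⟨⟨a, b⟩, d, e⟩ _ ⟨⟨a', b'⟩, d', e'⟩ _ h
          simp only [Prod.mk.injEq] at h ⊢
          tauto
    _ ≤ #{y ∈ (W ×ˢ W) ×ˢ (Z ×ˢ Z) | ‖y.1.1‖ = ‖y.1.2‖ ∧ OnCurve y.1 y.2} +
        #{y ∈ (W ×ˢ W) ×ˢ (Z ×ˢ Z) | Nondegenerate y.1 ∧ OnCurve y.1 y.2} := by
      refine (card_le_card fun y hy => ?_).trans (card_union_le _ _)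
      simp only [mem_union, mem_filter, mem_product] at hy ⊢
      by_cases h : ‖y.1.1‖ = ‖y.1.2‖
      · exact .inl ⟨hy.1, h, hy.2⟩
      · exact .inr ⟨hy.1, ⟨hW _ hy.1.1.1, hW _ hy.1.1.2, h⟩, hy.2⟩
    _ ≤ 2 * (#W * #Z ^ 2) + (32 * t * #W ^ 2 + t ^ 2 * M ^ 8) := by
      refine Nat.add_le_add (card_norm_eq_le hZ) ?_
      refine le_trans (le_of_eq ?_) (card_nondegenerate_le (W := W) hZ hct hc hcM)
      rw [card_filter, sum_product, sum_filter]
      refine sum_congr rfl fun w _ => ?_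
      by_cases hw : Nondegenerate w
      · simp only [hw, true_and, card_filter, if_true]
      · simp [hw]
    _ = _ := by ring

lemma le_mul_of_forall_sq_le {c : ℝ} (hc : 0 < c) {k N n D : ℕ} (hn : 0 < n) (hNn : N ≤ n)
    (hnN : n ≤ 2 * N) (hkn : k ≤ n) (hk : c * (n : ℝ) ^ ((5 : ℝ) / 6) ≤ k)
    (h : ∀ t M : ℕ, 0 < M → k ≤ t * M →
      (k * N) ^ 2 ≤ D * (2 * (N * k ^ 2) + 32 * t * N ^ 2 + t ^ 2 * M ^ 8)) :
    (n : ℝ) ≤ 4 * (34 + 32 / c ^ 2 + 256 / c ^ 6) * D := by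
  have hn1 : (1 : ℝ) ≤ n := by exact_mod_cast hn
  have hn0 : (0 : ℝ) < n := by linarith
  have hk0 : (0 : ℝ) < k := lt_of_lt_of_le (by positivity) hk
  have hkn' : (k : ℝ) ≤ n := by exact_mod_cast hkn
  have hNn' : (N : ℝ) ≤ n := by exact_mod_cast hNn
  have hnN' : (n : ℝ) ≤ 2 * N := by exact_mod_cast hnN
  have hk6 : c ^ 6 * (n : ℝ) ^ 5 ≤ (k : ℝ) ^ 6 := by
    have := pow_le_pow_left₀ (by positivity) hk 6
    rw [mul_pow, ← Real.rpow_natCast ((n : ℝ) ^ ((5 : ℝ) / 6)), ← Real.rpow_mul hn0.le] at this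
    norm_num at this
    exact_mod_cast this
  have hk2 : c ^ 2 * (n : ℝ) ≤ (k : ℝ) ^ 2 := by
    have h1 : (n : ℝ) ≤ ((n : ℝ) ^ ((5 : ℝ) / 6)) ^ 2 := by
      rw [← Real.rpow_natCast, ← Real.rpow_mul hn0.le]
      exact Real.self_le_rpow_of_one_le hn1 (by norm_num)
    calc c ^ 2 * (n : ℝ) ≤ c ^ 2 * ((n : ℝ) ^ ((5 : ℝ) / 6)) ^ 2 := by gcongr
      _ = (c * (n : ℝ) ^ ((5 : ℝ) / 6)) ^ 2 := by ring
      _ ≤ _ := by gcongr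
  let t : ℕ := ⌈(k : ℝ) ^ 2 / n⌉₊
  have ht0 : 0 < t := Nat.ceil_pos.2 (by positivity)
  have ht0' : (0 : ℝ) < t := by exact_mod_cast ht0
  have htk : t ≤ k := Nat.ceil_le.2 (by
    rw [div_le_iff₀ hn0, sq]
    gcongr)
  have htk' : (t : ℝ) ≤ k := by exact_mod_cast htk
  have ht_le : (t : ℝ) ≤ (k : ℝ) ^ 2 / n + 1 := (Nat.ceil_lt_add_one (by positivity)).le
  have le_t : (k : ℝ) ^ 2 / n ≤ t := Nat.le_ceil _
  let M : ℕ := k / t + 1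
  have hM : (M : ℝ) ≤ 2 * k / t := by
    have h1 : ((k / t : ℕ) : ℝ) ≤ k / t := Nat.cast_div_le
    have h2 : (1 : ℝ) ≤ k / t := (one_le_div ht0').2 htk'
    have h3 : (2 * k / t : ℝ) = k / t + k / t := by ring
    simp only [M]
    push_cast
    linarith
  have main := h t M (Nat.succ_pos _) (Nat.lt_mul_div_succ k ht0).le
  have main' : ((k : ℝ) * N) ^ 2 ≤
      D * (2 * (N * k ^ 2) + 32 * t * N ^ 2 + t ^ 2 * M ^ 8) := by exact_mod_cast main
  have b₁ : 2 * ((N : ℝ) * k ^ 2) ≤ 2 * ((k : ℝ) ^ 2 * n) := by nlinarith [sq_nonneg (k : ℝ)]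
  have b₂ : 32 * (t : ℝ) * N ^ 2 ≤ (32 + 32 / c ^ 2) * ((k : ℝ) ^ 2 * n) := by
    calc 32 * (t : ℝ) * N ^ 2 ≤ 32 * ((k : ℝ) ^ 2 / n + 1) * n ^ 2 := by gcongr
      _ = 32 * ((k : ℝ) ^ 2 * n) + 32 / c ^ 2 * ((c ^ 2 * n) * n) := by field_simp
      _ ≤ 32 * ((k : ℝ) ^ 2 * n) + 32 / c ^ 2 * ((k : ℝ) ^ 2 * n) := by gcongr
      _ = _ := by ring
  have b₃ : (t : ℝ) ^ 2 * M ^ 8 ≤ 256 / c ^ 6 * ((k : ℝ) ^ 2 * n) := by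
    calc (t : ℝ) ^ 2 * M ^ 8 ≤ (t : ℝ) ^ 2 * (2 * k / t) ^ 8 := by gcongr
      _ = 256 * (k : ℝ) ^ 8 / t ^ 6 := by field_simp; ring
      _ ≤ 256 * (k : ℝ) ^ 8 / ((k : ℝ) ^ 2 / n) ^ 6 := by gcongr
      _ = 256 / c ^ 6 * (n * (c ^ 6 * (n : ℝ) ^ 5)) / k ^ 4 := by field_simp
      _ ≤ 256 / c ^ 6 * (n * (k : ℝ) ^ 6) / k ^ 4 := by gcongr
      _ = _ := by field_simp
  have b₅ : 2 * ((N : ℝ) * k ^ 2) + 32 * t * N ^ 2 + t ^ 2 * M ^ 8 ≤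
      (34 + 32 / c ^ 2 + 256 / c ^ 6) * ((k : ℝ) ^ 2 * n) := by
    linear_combination b₁ + b₂ + b₃
  have b₄ : (k : ℝ) ^ 2 * n * n ≤ 4 * ((k : ℝ) * N) ^ 2 := by
    calc (k : ℝ) ^ 2 * n * n ≤ (k : ℝ) ^ 2 * (2 * N) * (2 * N) := by gcongr
      _ = 4 * ((k : ℝ) * N) ^ 2 := by ring
  have hpos : (0 : ℝ) < (k : ℝ) ^ 2 * n := by positivity
  refine le_of_mul_le_mul_left ?_ hpos
  calc (k : ℝ) ^ 2 * n * n ≤ 4 * ((k : ℝ) * N) ^ 2 := b₄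
    _ ≤ 4 * (D * (2 * (N * k ^ 2) + 32 * t * N ^ 2 + t ^ 2 * M ^ 8)) :=
      mul_le_mul_of_nonneg_left main' (by norm_num)
    _ ≤ 4 * (D * ((34 + 32 / c ^ 2 + 256 / c ^ 6) * ((k : ℝ) ^ 2 * n))) := by
      refine mul_le_mul_of_nonneg_left (mul_le_mul_of_nonneg_left b₅ D.cast_nonneg) (by norm_num)
    _ = _ := by ring

theorem card_distances_ge {a : ℝ} (ha : 0 < a) : ∃ b : ℝ, 0 < b ∧ ∀ P : Finset ℂ, 2 ≤ #P →
    a * (#P : ℝ) ^ ((5 : ℝ) / 6) ≤ #{z ∈ P | ‖z‖ = 1} →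
    b * #P ≤ #(P.offDiag.image fun x => ‖x.1 - x.2‖) := by
  set K : ℝ := 34 + 32 / (a / 2) ^ 2 + 256 / (a / 2) ^ 6 with hK
  have hK0 : 0 < K := by positivity
  refine ⟨1 / (8 * K), by positivity, fun P hP hS => ?_⟩
  obtain ⟨Z, hZP, hZ, harg, hcard⟩ : ∃ Z ⊆ P, (∀ z ∈ Z, ‖z‖ = 1) ∧
      ((∀ z ∈ Z, 0 < z.arg) ∨ (∀ z ∈ Z, z.arg ≤ 0)) ∧ #{z ∈ P | ‖z‖ = 1} ≤ 2 * #Z := by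
    have hsplit := card_filter_add_card_filter_not (s := {z ∈ P | ‖z‖ = 1}) (fun z => 0 < z.arg)
    rcases le_total #{z ∈ {z ∈ P | ‖z‖ = 1} | 0 < z.arg} #{z ∈ {z ∈ P | ‖z‖ = 1} | ¬ 0 < z.arg}
      with h | h
    · exact ⟨{z ∈ {z ∈ P | ‖z‖ = 1} | ¬ 0 < z.arg}, (filter_subset _ _).trans (filter_subset _ _),
        fun z hz => (mem_filter.1 (mem_filter.1 hz).1).2,
        .inr fun z hz => not_lt.1 (mem_filter.1 hz).2, by omega⟩
    · exact ⟨{z ∈ {z ∈ P | ‖z‖ = 1} | 0 < z.arg}, (filter_subset _ _).trans (filter_subset _ _),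
        fun z hz => (mem_filter.1 (mem_filter.1 hz).1).2,
        .inl fun z hz => (mem_filter.1 hz).2, by omega⟩
  set D := #(P.offDiag.image fun x => ‖x.1 - x.2‖) with hD
  have hD1 : 1 ≤ D := by
    rw [hD, Nat.one_le_iff_ne_zero, ← Nat.pos_iff_ne_zero, card_pos, image_nonempty,
      ← card_pos, offDiag_card]
    nlinarith [Nat.sub_pos_of_lt (show #P < #P * #P by nlinarith)]
  have hD' : #((Z ×ˢ P.erase 0).image fun x => ‖x.1 - x.2‖) ≤ D + 1 := by
    refine (card_le_card fun d hd => ?_).trans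
      (card_insert_le (0 : ℝ) (P.offDiag.image fun x => ‖x.1 - x.2‖))
    simp only [mem_image, mem_product, mem_erase] at hd
    obtain ⟨⟨p, q⟩, ⟨hp, -, hq⟩, rfl⟩ := hd
    by_cases h : p = q
    · simp [h]
    · exact mem_insert_of_mem (mem_image.2 ⟨(p, q), mem_offDiag.2 ⟨hZP hp, hq, h⟩, rfl⟩)
  have hmain := le_mul_of_forall_sq_le (c := a / 2) (by positivity) (k := #Z) (N := #(P.erase 0))
    (n := #P) (D := #((Z ×ˢ P.erase 0).image fun x => ‖x.1 - x.2‖)) (by omega)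
    (card_le_card (erase_subset _ _))
    (by have := pred_card_le_card_erase (s := P) (a := 0); omega)
    (card_le_card hZP)
    (by
      have : (#{z ∈ P | ‖z‖ = 1} : ℝ) ≤ 2 * #Z := by exact_mod_cast hcard
      linarith)
    (fun t M hM htM => card_mul_card_sq_le hZ harg (fun w hw => (mem_erase.1 hw).1) hM htM)
  rw [← hK] at hmain
  have hD2 : (#((Z ×ˢ P.erase 0).image fun x => ‖x.1 - x.2‖) : ℝ) ≤ 2 * D := by
    exact_mod_cast (by omega : _ ≤ 2 * D)
  rw [div_mul_eq_mul_div, one_mul, div_le_iff₀ (by positivity)]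
  calc (#P : ℝ) ≤ _ := hmain
    _ ≤ 4 * K * (2 * D) := by gcongr
    _ = D * (8 * K) := by ring

end HeavyCircle

/-- If a set `P` of `n ≥ 2` points in the plane has a circle containing at least
`a · n^(5/6)` of its points, then `P` determines at least `b · n` distinct distances. -/
theorem few_distances_implies_no_heavy_circle :
    ∀ a : ℝ, 0 < a → ∃ b : ℝ, 0 < b ∧
      ∀ n : ℕ, 2 ≤ n →
      ∀ P : Finset (EuclideanSpace ℝ (Fin 2)), P.card = n →
      ∀ (z : EuclideanSpace ℝ (Fin 2)) (r : ℝ), 0 < r →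
        a * (n : ℝ) ^ ((5 : ℝ) / 6) ≤
          (((P : Set (EuclideanSpace ℝ (Fin 2))) ∩ Metric.sphere z r).ncard : ℝ) →
        b * (n : ℝ) ≤
          (({d : ℝ | ∃ p ∈ P, ∃ q ∈ P, p ≠ q ∧ d = dist p q}).ncard : ℝ) := by
  classical
  intro a ha
  obtain ⟨b, hb, hmain⟩ := HeavyCircle.card_distances_ge ha
  refine ⟨b, hb, ?_⟩
  rintro n hn P rfl z r hr hcirc
  let e := Complex.orthonormalBasisOneI.repr.symm
  let φ : EuclideanSpace ℝ (Fin 2) → ℂ := fun x => r⁻¹ • (e x - e z)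
  have hφ : ∀ x y, ‖φ x - φ y‖ = r⁻¹ * dist x y := by
    intro x y
    rw [← smul_sub, sub_sub_sub_cancel_right, norm_smul, ← map_sub, e.norm_map, ← dist_eq_norm,
      Real.norm_of_nonneg (by positivity)]
  have hφz : ∀ x, ‖φ x‖ = r⁻¹ * dist x z := by
    intro x
    have h0 : φ z = 0 := by simp [φ]
    rw [← hφ, h0, sub_zero]
  have hinj : Function.Injective φ := by
    intro x y h
    have := hφ x y
    rw [h, sub_self, norm_zero, eq_comm, mul_eq_zero] at this
    exact dist_eq_zero.1 (this.resolve_left (by positivity))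
  have hcard : (P.image φ).card = P.card := Finset.card_image_of_injective _ hinj
  have hsphere : ((P : Set (EuclideanSpace ℝ (Fin 2))) ∩ Metric.sphere z r).ncard =
      ((P.image φ).filter fun w => ‖w‖ = 1).card := by
    rw [Finset.filter_image, Finset.card_image_of_injective _ hinj, ← Set.ncard_coe_finset]
    congr 1
    ext x
    simp [hφz, inv_mul_eq_one₀ hr.ne', dist_eq_norm, eq_comm]
  have hdist : {d : ℝ | ∃ p ∈ P, ∃ q ∈ P, p ≠ q ∧ d = dist p q} =
      (P.offDiag.image fun x => dist x.1 x.2 : Finset ℝ) := by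
    ext d
    simp only [Set.mem_ofPred_eq, Finset.coe_image, Set.mem_image, Finset.mem_coe,
      Finset.mem_offDiag, Prod.exists]
    constructor
    · rintro ⟨p, hp, q, hq, hpq, rfl⟩
      exact ⟨p, q, ⟨hp, hq, hpq⟩, rfl⟩
    · rintro ⟨p, q, ⟨hp, hq, hpq⟩, rfl⟩
      exact ⟨p, hp, q, hq, hpq, rfl⟩
  have himage : ((P.image φ).offDiag.image fun x => ‖x.1 - x.2‖) ⊆
      (P.offDiag.image fun x => dist x.1 x.2).image (r⁻¹ * ·) := by
    intro d hd
    obtain ⟨⟨u, v⟩, huv, rfl⟩ := Finset.mem_image.1 hd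
    obtain ⟨hu, hv, huv⟩ := Finset.mem_offDiag.1 huv
    obtain ⟨p, hp, rfl⟩ := Finset.mem_image.1 hu
    obtain ⟨q, hq, rfl⟩ := Finset.mem_image.1 hv
    refine Finset.mem_image.2 ⟨dist p q, Finset.mem_image.2 ⟨(p, q), ?_, rfl⟩, (hφ p q).symm⟩
    exact Finset.mem_offDiag.2 ⟨hp, hq, fun h => huv (congrArg φ h)⟩
  rw [hdist, Set.ncard_coe_finset]
  rw [hsphere, ← hcard] at hcirc
  have := hmain _ (hcard ▸ hn) hcirc
  rw [hcard] at this
  refine this.trans ?_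
  exact_mod_cast (Finset.card_le_card himage).trans Finset.card_image_le
end
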